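/- For every integer n ≥ 8, \bar{p}(n)² − \bar{p}(n−1)·\bar{p}(n+1) − \bar{p}(n)·\bar{p}(n+1) + \bar{p}(n+1)² + \bar{p}(n−1)·\bar{p}(n+2) − \bar{p}(n)·\bar{p}(n+2) > 0. -/

import Mathlib

/-- The overpartition function: `Σ_{λ ⊢ n} 2^{d(λ)}` where `d(λ)` is the number of
distinct part sizes of the partition `λ`. -/
def overpartitionFn (n : ℕ) : ℕ :=
  ∑ μ : Nat.Partition n, 2 ^ μ.parts.toFinset.card

open Filter Topology

namespace Overpartition

/-- The power series `(1 + X ^ i) / (1 - X ^ i)` counting overpartitions with all parts equal to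
`i`. -/
noncomputable def partFactor (i : ℕ) : PowerSeries ℝ :=
  PowerSeries.mk fun m ↦ if m = 0 then 1 else if i ∣ m then 2 else 0

/-- The generating function of overpartitions with parts at most `N`. -/
noncomputable def truncatedGenFun (N : ℕ) : PowerSeries ℝ :=
  ∏ i ∈ Finset.range N, partFactor (i + 1)

open PowerSeries.WithPiTopology in
theorem partFactor_succ_eq (i : ℕ) :
    partFactor (i + 1) = 1 + ∑' j : ℕ, (2 : ℝ) • (PowerSeries.X : PowerSeries ℝ) ^ ((i + 1) * (j + 1)) := by
  have hs := Nat.Partition.summable_genFun_term (R := ℝ) (fun _ _ ↦ (2 : ℝ)) i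
  ext m
  have h := (hs.hasSum.map (PowerSeries.coeff (R := ℝ) m)
    (PowerSeries.WithPiTopology.continuous_coeff ℝ m)).tsum_eq
  rw [map_add, ← h]
  simp only [Function.comp_def, map_smul, PowerSeries.coeff_X_pow, smul_eq_mul, mul_ite, mul_one,
    mul_zero, partFactor, PowerSeries.coeff_mk, PowerSeries.coeff_one]
  rcases Nat.eq_zero_or_pos m with rfl | hm
  · simp
  rw [if_neg hm.ne', if_neg hm.ne', zero_add]
  split_ifs with hd
  · obtain ⟨k, rfl⟩ := hd
    have hk : k ≠ 0 := by rintro rfl; simp at hm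
    rw [tsum_eq_single (k - 1)]
    · rw [if_pos]; congr; omega
    · intro j hj
      rw [if_neg]
      intro h
      have := Nat.eq_of_mul_eq_mul_left (Nat.succ_pos i) h
      omega
  · symm
    convert! tsum_zero with j
    rw [if_neg]
    rintro rfl
    exact hd (dvd_mul_right _ _)

theorem tendsto_coeff_truncatedGenFun (n : ℕ) :
    Tendsto (fun N ↦ PowerSeries.coeff n (truncatedGenFun N)) atTop (𝓝 (overpartitionFn n : ℝ)) := by
  open PowerSeries.WithPiTopology in
  have h := (Nat.Partition.hasProd_genFun (R := ℝ) (fun _ _ ↦ (2 : ℝ))).tendsto_prod_nat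
  simp_rw [← partFactor_succ_eq] at h
  have h2 := ((PowerSeries.WithPiTopology.continuous_coeff ℝ n).tendsto _).comp h
  convert! h2 using 2
  rw [Nat.Partition.coeff_genFun, overpartitionFn]
  push_cast
  refine Finset.sum_congr rfl fun p _ ↦ ?_
  simp [Finsupp.prod]

theorem coeff_partFactor_nonneg (i m : ℕ) : 0 ≤ PowerSeries.coeff m (partFactor i) := by
  rw [partFactor, PowerSeries.coeff_mk]
  split_ifs <;> norm_num

theorem coeff_truncatedGenFun_nonneg (N n : ℕ) : 0 ≤ PowerSeries.coeff n (truncatedGenFun N) := by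
  induction N generalizing n with
  | zero => simp only [truncatedGenFun, Finset.range_zero, Finset.prod_empty, PowerSeries.coeff_one]
            split_ifs <;> norm_num
  | succ N ih =>
    rw [truncatedGenFun, Finset.prod_range_succ, ← truncatedGenFun, PowerSeries.coeff_mul]
    exact Finset.sum_nonneg fun p _ ↦ mul_nonneg (ih _) (coeff_partFactor_nonneg _ _)

theorem monotone_coeff_truncatedGenFun (n : ℕ) :
    Monotone fun N ↦ PowerSeries.coeff n (truncatedGenFun N) := by
  refine monotone_nat_of_le_succ fun N ↦ ?_
  conv_rhs => rw [truncatedGenFun, Finset.prod_range_succ, ← truncatedGenFun, PowerSeries.coeff_mul]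
  have := Finset.single_le_sum (f := fun p : ℕ × ℕ ↦ PowerSeries.coeff p.1 (truncatedGenFun N) *
    PowerSeries.coeff p.2 (partFactor (N + 1))) (s := Finset.HasAntidiagonal.antidiagonal n) (a := (n, 0))
    (fun p _ ↦ mul_nonneg (coeff_truncatedGenFun_nonneg _ _) (coeff_partFactor_nonneg _ _)) (by simp)
  simpa [partFactor] using this

theorem coeff_truncatedGenFun_le (N n : ℕ) :
    PowerSeries.coeff n (truncatedGenFun N) ≤ overpartitionFn n :=
  (monotone_coeff_truncatedGenFun n).ge_of_tendsto (tendsto_coeff_truncatedGenFun n) N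

theorem hasSum_partFactor {i : ℕ} (hi : i ≠ 0) {q : ℂ} (hq : ‖q‖ < 1) :
    HasSum (fun m ↦ ((PowerSeries.coeff m (partFactor i) : ℝ) : ℂ) * q ^ m)
      ((1 + q ^ i) / (1 - q ^ i)) := by
  have hqi : ‖q ^ i‖ < 1 := by rw [norm_pow]; exact pow_lt_one₀ (norm_nonneg _) hq hi
  have hne : 1 - q ^ i ≠ 0 := by
    intro h
    rw [← sub_eq_zero.mp h] at hqi
    simp at hqi
  have hinj : Function.Injective fun j : ℕ ↦ i * j := fun a b h ↦
    Nat.eq_of_mul_eq_mul_left (Nat.pos_of_ne_zero hi) h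
  rw [← hinj.hasSum_iff]
  · have h1 := ((hasSum_geometric_of_norm_lt_one hqi).mul_left 2).sub (hasSum_ite_eq 0 (1 : ℂ))
    convert! h1 using 1
    · funext j
      rcases eq_or_ne j 0 with rfl | hj
      · simp [partFactor]; norm_num
      · simp [partFactor, hi, hj, pow_mul]
    · field_simp; ring
  · intro m hm
    have hd : ¬ i ∣ m := by
      rintro ⟨k, rfl⟩
      exact hm ⟨k, rfl⟩
    have h0 : m ≠ 0 := by rintro rfl; exact hd (dvd_zero _)
    simp [partFactor, hd, h0]

theorem hasSum_truncatedGenFun {q : ℂ} (hq : ‖q‖ < 1) (N : ℕ) :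
    HasSum (fun n ↦ ((PowerSeries.coeff n (truncatedGenFun N) : ℝ) : ℂ) * q ^ n)
      (∏ i ∈ Finset.range N, (1 + q ^ (i + 1)) / (1 - q ^ (i + 1))) := by
  induction N with
  | zero =>
    convert! hasSum_ite_eq 0 (1 : ℂ) using 2 with n
    · simp only [truncatedGenFun, Finset.range_zero, Finset.prod_empty, PowerSeries.coeff_one]
      split_ifs with h <;> simp [h]
  | succ N ih =>
    have hf := hasSum_partFactor (Nat.succ_ne_zero N) hq
    rw [Finset.prod_range_succ, ← ih.tsum_eq, ← hf.tsum_eq,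
      tsum_mul_tsum_eq_tsum_sum_antidiagonal_of_summable_norm ih.summable.norm hf.summable.norm]
    have hs := (summable_norm_sum_mul_antidiagonal_of_summable_norm ih.summable.norm
      hf.summable.norm).of_norm
    convert! hs.hasSum using 2 with n
    rw [truncatedGenFun, Finset.prod_range_succ, ← truncatedGenFun, PowerSeries.coeff_mul]
    push_cast
    rw [Finset.sum_mul]
    refine Finset.sum_congr rfl fun p hp ↦ ?_
    rw [← Finset.HasAntidiagonal.mem_antidiagonal.mp hp, pow_add]
    ring

theorem hasSum_one_sub_neg_one_pow_div_sq :
    HasSum (fun n : ℕ ↦ (1 - (-1) ^ n) / (n : ℝ) ^ 2) (Real.pi ^ 2 / 4) := by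
  have h1 := hasSum_zeta_two
  have hinj : Function.Injective fun j : ℕ ↦ 2 * j := fun a b h ↦ by simpa using h
  have h2 : HasSum (fun n : ℕ ↦ (1 + (-1) ^ n) / (n : ℝ) ^ 2) (1 / 2 * (Real.pi ^ 2 / 6)) := by
    rw [← hinj.hasSum_iff]
    · convert! h1.mul_left (1 / 2) using 2 with n
      simp [pow_mul]
      ring
    · intro m hm
      have : Odd m := by
        rw [← Nat.not_even_iff_odd]
        rintro ⟨k, rfl⟩
        exact hm ⟨k, by simp; ring⟩
      simp [this.neg_one_pow]
  convert! (h1.mul_left 2).sub h2 using 1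
  · funext n; ring
  · ring

theorem hasSum_log_norm_one_add_div_one_sub {w : ℂ} (hw : ‖w‖ < 1) :
    HasSum (fun n : ℕ ↦ (1 - (-1) ^ n) / (n : ℝ) * (w ^ n).re)
      (Real.log ‖(1 + w) / (1 - w)‖) := by
  have h1 := Complex.hasSum_taylorSeries_neg_log hw
  have h2 := Complex.hasSum_taylorSeries_neg_log (z := -w) (by simpa using hw)
  have h3 := Complex.hasSum_re (h1.sub h2)
  have ne1 : 1 + w ≠ 0 := by
    intro h
    rw [← neg_eq_iff_add_eq_zero.mpr h] at hw
    simp at hw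
  have ne2 : 1 - w ≠ 0 := by
    intro h
    rw [← sub_eq_zero.mp h] at hw
    simp at hw
  convert! h3 using 1
  · funext n
    have : w ^ n / (n : ℂ) - (-w) ^ n / n = (((1 - (-1) ^ n) / (n : ℝ) : ℝ) : ℂ) * w ^ n := by
      rw [neg_pow]; push_cast; ring
    rw [this, Complex.re_ofReal_mul]
  · rw [norm_div, Real.log_div (by simpa) (by simpa)]
    simp [Complex.log_re]
    ring

theorem sum_pow_le_of_exp {x : ℝ} (hx : 0 < x) (N : ℕ) :
    ∑ i ∈ Finset.range N, Real.exp (-x) ^ (i + 1) ≤ 1 / x := by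
  have h1 : Real.exp (-x) < 1 := by simpa using hx
  calc ∑ i ∈ Finset.range N, Real.exp (-x) ^ (i + 1)
      = Real.exp (-x) * ∑ i ∈ Finset.range N, Real.exp (-x) ^ i := by
        rw [Finset.mul_sum]; exact Finset.sum_congr rfl fun i _ ↦ by ring
    _ ≤ Real.exp (-x) * (1 - Real.exp (-x))⁻¹ := by
        gcongr
        rw [← tsum_geometric_of_lt_one (Real.exp_pos _).le h1]
        exact (summable_geometric_of_lt_one (Real.exp_pos _).le h1).sum_le_tsum _
          fun i _ ↦ by positivity
    _ ≤ 1 / x := by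
        rw [← div_eq_mul_inv, div_le_div_iff₀ (by linarith) hx]
        have h2 := Real.add_one_le_exp x
        have h3 : Real.exp (-x) * Real.exp x = 1 := by rw [← Real.exp_add]; simp
        nlinarith [Real.exp_pos (-x)]

/-- A bound for the finite products which retains the size of the first harmonic. -/
theorem norm_prod_le {q : ℂ} {x : ℝ} (hx : 0 < x) (hq : ‖q‖ = Real.exp (-x)) (N : ℕ) :
    ‖∏ i ∈ Finset.range N, (1 + q ^ (i + 1)) / (1 - q ^ (i + 1))‖ ≤
      Real.exp (2 * ‖∑ i ∈ Finset.range N, q ^ (i + 1)‖ + (Real.pi ^ 2 / 4 - 2) / x) := by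
  have hq1 : ‖q‖ < 1 := by rw [hq]; simpa using hx
  have hqi (i : ℕ) : ‖q ^ (i + 1)‖ < 1 := by
    rw [norm_pow]; exact pow_lt_one₀ (norm_nonneg _) hq1 (Nat.succ_ne_zero i)
  have hne (i : ℕ) : 0 < ‖(1 + q ^ (i + 1)) / (1 - q ^ (i + 1))‖ := by
    rw [norm_pos_iff]
    refine div_ne_zero (fun h ↦ ?_) (fun h ↦ ?_)
    · have := hqi i
      rw [← neg_eq_iff_add_eq_zero.mpr h] at this
      simp at this
    · have := hqi i
      rw [← sub_eq_zero.mp h] at this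
      simp at this
  rw [norm_prod, ← Real.log_le_iff_le_exp (Finset.prod_pos fun i _ ↦ hne i),
    Real.log_prod fun i _ ↦ (hne i).ne']
  have h1 := hasSum_sum (f := fun i (n : ℕ) ↦ (1 - (-1) ^ n) / (n : ℝ) * ((q ^ (i + 1)) ^ n).re)
    (s := Finset.range N) fun i _ ↦ hasSum_log_norm_one_add_div_one_sub (hqi i)
  have h2 := (hasSum_one_sub_neg_one_pow_div_sq.div_const x).add
    (hasSum_ite_eq 1 (2 * ‖∑ i ∈ Finset.range N, q ^ (i + 1)‖ - 2 / x))
  refine (hasSum_le (fun n ↦ ?_) h1 h2).trans_eq (by ring)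
  rw [← Finset.mul_sum, ← Complex.re_sum]
  have hc : 0 ≤ (1 - (-1 : ℝ) ^ n) := by
    rcases neg_one_pow_eq_or ℝ n with h | h <;> rw [h] <;> norm_num
  rcases eq_or_ne n 1 with rfl | hn
  · simp only [if_true]
    have := Complex.re_le_norm (∑ i ∈ Finset.range N, q ^ (i + 1))
    norm_num
    rw [Complex.re_sum] at this
    ring_nf at this ⊢
    linarith
  · rw [if_neg hn, add_zero]
    rcases Nat.eq_zero_or_pos n with rfl | hn0
    · simp
    have hn' : (0 : ℝ) < n := by exact_mod_cast hn0
    have h3 : (∑ i ∈ Finset.range N, (q ^ (i + 1)) ^ n).re ≤ 1 / (n * x) := by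
      refine (Complex.re_le_norm _).trans ((norm_sum_le _ _).trans ?_)
      refine le_trans (le_of_eq ?_) (sum_pow_le_of_exp (x := n * x) (by positivity) N)
      refine Finset.sum_congr rfl fun i _ ↦ ?_
      rw [norm_pow, norm_pow, hq, ← Real.exp_nat_mul, ← Real.exp_nat_mul, ← Real.exp_nat_mul]
      congr 1; push_cast; ring
    calc _ ≤ (1 - (-1) ^ n) / (n : ℝ) * (1 / (n * x)) := by gcongr
      _ = _ := by field_simp

theorem norm_prod_le_exp {q : ℂ} {x : ℝ} (hx : 0 < x) (hq : ‖q‖ = Real.exp (-x)) (N : ℕ) :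
    ‖∏ i ∈ Finset.range N, (1 + q ^ (i + 1)) / (1 - q ^ (i + 1))‖ ≤
      Real.exp (Real.pi ^ 2 / (4 * x)) := by
  refine (norm_prod_le hx hq N).trans (Real.exp_le_exp.mpr ?_)
  have h : ‖∑ i ∈ Finset.range N, q ^ (i + 1)‖ ≤ 1 / x := by
    refine (norm_sum_le _ _).trans ?_
    simp_rw [norm_pow, hq]
    exact sum_pow_le_of_exp hx N
  calc _ ≤ 2 * (1 / x) + (Real.pi ^ 2 / 4 - 2) / x := by gcongr
    _ = _ := by field_simp; ring

theorem summable_overpartition {x : ℝ} (hx : 0 < x) :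
    Summable fun n ↦ (overpartitionFn n : ℝ) * Real.exp (-x) ^ n := by
  refine summable_of_sum_range_le (c := Real.exp (Real.pi ^ 2 / (4 * x)))
    (fun n ↦ by positivity) fun K ↦ ?_
  refine le_of_tendsto (f := fun N ↦ ∑ n ∈ Finset.range K,
    PowerSeries.coeff n (truncatedGenFun N) * Real.exp (-x) ^ n) (tendsto_finsetSum _ fun n _ ↦
      (tendsto_coeff_truncatedGenFun n).mul_const _) (Eventually.of_forall fun N ↦ ?_)
  have hq : ‖((Real.exp (-x) : ℝ) : ℂ)‖ = Real.exp (-x) := by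
    rw [Complex.norm_real, Real.norm_of_nonneg (Real.exp_pos _).le]
  have h := hasSum_truncatedGenFun (q := ((Real.exp (-x) : ℝ) : ℂ))
    (by rw [hq]; simpa using hx) N
  have h2 := Complex.hasSum_re h
  refine le_trans ?_ ((Complex.re_le_norm _).trans (norm_prod_le_exp hx hq N))
  convert! sum_le_hasSum (Finset.range K) _ h2 using 2 with n
  · rw [← Complex.ofReal_pow, ← Complex.ofReal_mul, Complex.ofReal_re]
  · intro n _
    rw [← Complex.ofReal_pow, ← Complex.ofReal_mul, Complex.ofReal_re]
    exact mul_nonneg (coeff_truncatedGenFun_nonneg _ _) (by positivity)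

/-- The generating function of overpartitions. -/
noncomputable def genFun (q : ℂ) : ℂ := ∑' n, (overpartitionFn n : ℂ) * q ^ n

theorem summable_norm_overpartition {q : ℂ} (hq : ‖q‖ < 1) :
    Summable fun n ↦ ‖(overpartitionFn n : ℂ) * q ^ n‖ := by
  rcases eq_or_ne q 0 with rfl | h0
  · refine summable_of_ne_finset_zero (s := {0}) fun n hn ↦ ?_
    simp only [Finset.mem_singleton] at hn
    simp [hn]
  · have hp : 0 < ‖q‖ := norm_pos_iff.mpr h0
    have h := summable_overpartition (x := -Real.log ‖q‖) (by
      simpa using Real.log_neg hp hq)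
    rw [neg_neg, Real.exp_log hp] at h
    simpa using h

theorem tendsto_prod_genFun {q : ℂ} (hq : ‖q‖ < 1) :
    Tendsto (fun N ↦ ∏ i ∈ Finset.range N, (1 + q ^ (i + 1)) / (1 - q ^ (i + 1))) atTop
      (𝓝 (genFun q)) := by
  simp_rw [← (hasSum_truncatedGenFun hq _).tsum_eq]
  refine tendsto_tsum_of_dominated_convergence (summable_norm_overpartition hq) (fun n ↦ ?_)
    (Eventually.of_forall fun N n ↦ ?_)
  · refine Tendsto.mul_const _ ?_
    have h := (Complex.continuous_ofReal.tendsto _).comp (tendsto_coeff_truncatedGenFun n)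
    simpa [Function.comp_def] using h
  · rw [norm_mul, norm_mul, Complex.norm_real, Real.norm_of_nonneg (coeff_truncatedGenFun_nonneg _ _)]
    gcongr
    simpa using coeff_truncatedGenFun_le N n

theorem norm_genFun_le {q : ℂ} {x : ℝ} (hx : 0 < x) (hq : ‖q‖ = Real.exp (-x)) :
    ‖genFun q‖ ≤ Real.exp (2 * ‖q / (1 - q)‖ + (Real.pi ^ 2 / 4 - 2) / x) := by
  have hq1 : ‖q‖ < 1 := by rw [hq]; simpa using hx
  have hg : Tendsto (fun N ↦ ∑ i ∈ Finset.range N, q ^ (i + 1)) atTop (𝓝 (q / (1 - q))) := by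
    have := ((hasSum_geometric_of_norm_lt_one hq1).mul_left q).tendsto_sum_nat
    simpa [pow_succ', div_eq_mul_inv] using this
  refine le_of_tendsto_of_tendsto (tendsto_prod_genFun hq1).norm ?_
    (Eventually.of_forall fun N ↦ norm_prod_le hx hq N)
  exact (Real.continuous_exp.tendsto _).comp ((hg.norm.const_mul 2).add_const _)

/-- The theta series `∑ (-1) ^ n * q ^ n ^ 2` over all integers `n`. -/
noncomputable def theta (q : ℂ) : ℂ := 1 + 2 * ∑' j : ℕ, (-1) ^ (j + 1) * q ^ (j + 1) ^ 2

/-- The coefficient `(X; q)_n / (-X; q)_{n + 1}` with `X = q ^ (m + 1)`. -/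
noncomputable def pochhammerRatio (q : ℂ) (m n : ℕ) : ℂ :=
  (∏ i ∈ Finset.range n, (1 - q ^ (m + 1 + i))) / ∏ i ∈ Finset.range (n + 1), (1 + q ^ (m + 1 + i))

theorem one_add_pow_ne_zero {q : ℂ} (hq : ‖q‖ < 1) (i : ℕ) : 1 + q ^ (i + 1) ≠ 0 := by
  intro h
  have : ‖q ^ (i + 1)‖ < 1 := by
    rw [norm_pow]; exact pow_lt_one₀ (norm_nonneg _) hq (Nat.succ_ne_zero i)
  rw [← neg_eq_iff_add_eq_zero.mpr h] at this
  simp at this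

theorem one_sub_pow_ne_zero {q : ℂ} (hq : ‖q‖ < 1) (i : ℕ) : 1 - q ^ (i + 1) ≠ 0 := by
  intro h
  have : ‖q ^ (i + 1)‖ < 1 := by
    rw [norm_pow]; exact pow_lt_one₀ (norm_nonneg _) hq (Nat.succ_ne_zero i)
  rw [← sub_eq_zero.mp h] at this
  simp at this

theorem exists_norm_pochhammerRatio_le {q : ℂ} (hq : ‖q‖ < 1) :
    ∃ C : ℝ, ∀ m n, ‖pochhammerRatio q m n‖ ≤ C := by
  obtain ⟨x, hx, hqx⟩ : ∃ x : ℝ, 0 < x ∧ ‖q‖ ≤ Real.exp (-x) := by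
    rcases eq_or_ne q 0 with rfl | h0
    · exact ⟨1, one_pos, by simpa using (Real.exp_pos _).le⟩
    · have hp : 0 < ‖q‖ := norm_pos_iff.mpr h0
      exact ⟨-Real.log ‖q‖, by simpa using Real.log_neg hp hq, by rw [neg_neg, Real.exp_log hp]⟩
  set r := Real.exp (-x) with hr
  have hr1 : r < 1 := by rw [hr]; simpa using hx
  have hr0 : 0 < r := Real.exp_pos _
  have hpow (i : ℕ) : r ^ (i + 1) < 1 := pow_lt_one₀ hr0.le hr1 (Nat.succ_ne_zero i)
  have hqr (i : ℕ) : ‖q ^ i‖ ≤ r ^ i := by rw [norm_pow]; gcongr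
  have hfac (i : ℕ) : 1 ≤ (1 + r ^ (i + 1)) / (1 - r ^ (i + 1)) := by
    rw [one_le_div (by linarith [hpow i])]
    linarith [pow_pos hr0 (i + 1)]
  have hlow (i : ℕ) : 1 - r ^ (i + 1) ≤ ‖1 + q ^ (i + 1)‖ := by
    have := norm_sub_le (1 + q ^ (i + 1)) (q ^ (i + 1))
    simp only [add_sub_cancel_right, norm_one] at this
    linarith [hqr (i + 1)]
  have hup (i : ℕ) : ‖1 - q ^ (i + 1)‖ ≤ 1 + r ^ (i + 1) :=
    (norm_sub_le _ _).trans (by simpa using hqr (i + 1))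
  refine ⟨Real.exp (Real.pi ^ 2 / (4 * x)), fun m n ↦ ?_⟩
  have key := norm_prod_le_exp (q := (r : ℂ)) hx
    (by rw [Complex.norm_real, Real.norm_of_nonneg hr0.le]) (m + (n + 1))
  have hreal : ‖∏ i ∈ Finset.range (m + (n + 1)), (1 + (r : ℂ) ^ (i + 1)) / (1 - (r : ℂ) ^ (i + 1))‖ =
      ∏ i ∈ Finset.range (m + (n + 1)), (1 + r ^ (i + 1)) / (1 - r ^ (i + 1)) := by
    rw [← Real.norm_of_nonneg (Finset.prod_nonneg fun i _ ↦ zero_le_one.trans (hfac i)),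
      ← Complex.norm_real]
    push_cast
    rfl
  rw [hreal, Finset.prod_range_add] at key
  refine le_trans ?_ key
  rw [pochhammerRatio, norm_div, norm_prod, norm_prod]
  have h1 : (1 : ℝ) ≤ ∏ i ∈ Finset.range m, (1 + r ^ (i + 1)) / (1 - r ^ (i + 1)) :=
    Finset.one_le_prod fun i _ ↦ hfac i
  refine le_trans ?_ (le_mul_of_one_le_left
    (Finset.prod_nonneg fun i _ ↦ zero_le_one.trans (hfac _)) h1)
  rw [Finset.prod_div_distrib]
  have h2 : ∏ i ∈ Finset.range n, ‖1 - q ^ (m + 1 + i)‖ ≤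
      ∏ i ∈ Finset.range (n + 1), (1 + r ^ (m + i + 1)) := by
    rw [Finset.prod_range_succ]
    refine le_trans ?_ (le_mul_of_one_le_right (Finset.prod_nonneg fun i _ ↦ by positivity) ?_)
    · refine Finset.prod_le_prod (fun _ _ ↦ norm_nonneg _) fun i _ ↦ ?_
      rw [show m + 1 + i = m + i + 1 by ring]
      exact hup _
    · linarith [pow_pos hr0 (m + n + 1)]
  have h3 : ∏ i ∈ Finset.range (n + 1), (1 - r ^ (m + i + 1)) ≤
      ∏ i ∈ Finset.range (n + 1), ‖1 + q ^ (m + 1 + i)‖ := by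
    refine Finset.prod_le_prod (fun i _ ↦ by linarith [hpow (m + i)]) fun i _ ↦ ?_
    rw [show m + 1 + i = m + i + 1 by ring]
    exact hlow _
  have h4 : 0 < ∏ i ∈ Finset.range (n + 1), (1 - r ^ (m + i + 1)) :=
    Finset.prod_pos fun i _ ↦ by linarith [hpow (m + i)]
  gcongr

theorem summable_pochhammerRatio {q : ℂ} (hq : ‖q‖ < 1) (m : ℕ) :
    Summable fun n ↦ pochhammerRatio q m n * q ^ ((m + 1) * n) := by
  obtain ⟨C, hC⟩ := exists_norm_pochhammerRatio_le hq
  have h1 : ‖q‖ ^ (m + 1) < 1 := pow_lt_one₀ (norm_nonneg _) hq (Nat.succ_ne_zero m)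
  refine ((summable_geometric_of_lt_one (by positivity) h1).mul_left C).of_norm_bounded fun n ↦ ?_
  rw [norm_mul, norm_pow, pow_mul]
  gcongr
  exact hC m n

theorem pochhammerRatio_succ_right {q : ℂ} (m n : ℕ) :
    pochhammerRatio q m (n + 1) =
      pochhammerRatio q m n * (1 - q ^ (m + 1 + n)) / (1 + q ^ (m + 1 + (n + 1))) := by
  rw [pochhammerRatio, pochhammerRatio, Finset.prod_range_succ, Finset.prod_range_succ _ (n + 1),
    div_mul_eq_mul_div, div_div]

theorem pochhammerRatio_succ_left {q : ℂ} (hq : ‖q‖ < 1) (m n : ℕ) :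
    pochhammerRatio q (m + 1) n = pochhammerRatio q m n * ((1 - q ^ (m + 1 + n)) * (1 + q ^ (m + 1))) /
      ((1 - q ^ (m + 1)) * (1 + q ^ (m + 1 + n + 1))) := by
  have e1 : ∏ i ∈ Finset.range n, (1 - q ^ (m + 1 + 1 + i)) =
      (∏ i ∈ Finset.range n, (1 - q ^ (m + 1 + i))) * (1 - q ^ (m + 1 + n)) / (1 - q ^ (m + 1)) := by
    rw [← Finset.prod_range_succ, Finset.prod_range_succ', add_zero,
      mul_div_cancel_right₀ _ (one_sub_pow_ne_zero hq m)]
    exact Finset.prod_congr rfl fun i _ ↦ by ring_nf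
  have e2 : ∏ i ∈ Finset.range (n + 1), (1 + q ^ (m + 1 + 1 + i)) =
      (∏ i ∈ Finset.range (n + 1), (1 + q ^ (m + 1 + i))) * (1 + q ^ (m + 1 + n + 1)) /
        (1 + q ^ (m + 1)) := by
    rw [show m + 1 + n + 1 = m + 1 + (n + 1) by ring, ← Finset.prod_range_succ,
      Finset.prod_range_succ' _ (n + 1), add_zero,
      mul_div_cancel_right₀ _ (one_add_pow_ne_zero hq m)]
    exact Finset.prod_congr rfl fun i _ ↦ by ring_nf
  have n1 := one_add_pow_ne_zero hq m
  have n2 := one_sub_pow_ne_zero hq m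
  have n3 := one_add_pow_ne_zero hq (m + 1 + n)
  have n4 : ∏ i ∈ Finset.range (n + 1), (1 + q ^ (m + 1 + i)) ≠ 0 :=
    Finset.prod_ne_zero_iff.mpr fun i _ ↦ by
      rw [show m + 1 + i = m + i + 1 by ring]; exact one_add_pow_ne_zero hq _
  rw [pochhammerRatio, pochhammerRatio, e1, e2]
  field_simp

/-- The telescoping step behind the functional equation of `rogersFineSum`. -/
theorem pochhammerRatio_telescope {q : ℂ} (hq : ‖q‖ < 1) (m N : ℕ) :
    (∑ n ∈ Finset.range N, (pochhammerRatio q m n * q ^ ((m + 1) * n) +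
      q ^ (2 * m + 3) * (pochhammerRatio q (m + 1) n * q ^ ((m + 2) * n)))) =
      1 - q ^ ((m + 1) * N) * (1 - q ^ (N + 2 * (m + 1))) * pochhammerRatio q m N /
        (1 - q ^ (m + 1)) := by
  have n1 := one_add_pow_ne_zero hq m
  have n2 := one_sub_pow_ne_zero hq m
  induction N with
  | zero =>
    simp only [Finset.range_zero, Finset.sum_empty, mul_zero, pow_zero, zero_add, pochhammerRatio,
      Finset.prod_empty, Finset.prod_range_one, add_zero]
    rw [mul_comm 2, pow_mul]
    field_simp
    ring
  | succ n ih =>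
    have n3 := one_add_pow_ne_zero hq (m + 1 + n)
    rw [Finset.sum_range_succ, ih, pochhammerRatio_succ_right, pochhammerRatio_succ_left hq]
    rw [show m + 1 + (n + 1) = m + 1 + n + 1 by ring]
    field_simp
    ring

/-- The series whose value at `m = 0` is the Rogers-Fine expansion of the theta series. -/
noncomputable def rogersFineSum (q : ℂ) (m : ℕ) : ℂ :=
  ∑' n, pochhammerRatio q m n * q ^ ((m + 1) * n)

theorem rogersFineSum_eq {q : ℂ} (hq : ‖q‖ < 1) (m : ℕ) :
    rogersFineSum q m = 1 - q ^ (2 * m + 3) * rogersFineSum q (m + 1) := by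
  obtain ⟨C, hC⟩ := exists_norm_pochhammerRatio_le hq
  have h1 := ((summable_pochhammerRatio hq m).hasSum.add
    ((summable_pochhammerRatio hq (m + 1)).hasSum.mul_left (q ^ (2 * m + 3)))).tendsto_sum_nat
  have h2 : Tendsto (fun N ↦ 1 - q ^ ((m + 1) * N) * (1 - q ^ (N + 2 * (m + 1))) *
      pochhammerRatio q m N / (1 - q ^ (m + 1))) atTop (𝓝 1) := by
    have hz : Tendsto (fun N ↦ q ^ ((m + 1) * N) * (1 - q ^ (N + 2 * (m + 1))) *
      pochhammerRatio q m N) atTop (𝓝 0) := by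
      have hb : Tendsto (fun N : ℕ ↦ (‖q‖ ^ (m + 1)) ^ N * 2 * C) atTop (𝓝 0) := by
        have := (tendsto_pow_atTop_nhds_zero_of_lt_one (by positivity)
          (pow_lt_one₀ (norm_nonneg q) hq (Nat.succ_ne_zero m))).mul_const (2 * C)
        simpa [mul_assoc] using this
      refine squeeze_zero_norm (fun N ↦ ?_) hb
      rw [norm_mul, norm_mul, norm_pow, pow_mul]
      gcongr
      · refine (norm_sub_le _ _).trans ?_
        rw [norm_one, norm_pow]
        linarith [pow_le_one₀ (n := N + 2 * (m + 1)) (norm_nonneg q) hq.le]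
      · exact hC m N
    simpa using (hz.div_const (1 - q ^ (m + 1))).const_sub 1
  have h3 := tendsto_nhds_unique h1 (h2.congr fun N ↦ (pochhammerRatio_telescope hq m N).symm)
  rw [rogersFineSum, rogersFineSum]
  linear_combination h3

theorem rogersFineSum_zero_eq {q : ℂ} (hq : ‖q‖ < 1) (M : ℕ) :
    rogersFineSum q 0 = (∑ j ∈ Finset.range M, (-1) ^ j * q ^ (j ^ 2 + 2 * j)) +
      (-1) ^ M * q ^ (M ^ 2 + 2 * M) * rogersFineSum q M := by
  induction M with
  | zero => simp
  | succ M ih => rw [ih, Finset.sum_range_succ, rogersFineSum_eq hq M]; ring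

theorem summable_theta {q : ℂ} (hq : ‖q‖ < 1) :
    Summable fun j : ℕ ↦ ‖(-1) ^ (j + 1) * q ^ (j + 1) ^ 2‖ := by
  refine Summable.of_nonneg_of_le (fun _ ↦ norm_nonneg _) (fun j ↦ ?_)
    (summable_geometric_of_lt_one (norm_nonneg q) hq)
  simp only [norm_mul, norm_pow, norm_neg, norm_one, one_pow, one_mul]
  exact pow_le_pow_of_le_one (norm_nonneg _) hq.le (by nlinarith)

theorem theta_eq {q : ℂ} (hq : ‖q‖ < 1) : theta q = 1 - 2 * q * rogersFineSum q 0 := by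
  obtain ⟨C, hC⟩ := exists_norm_pochhammerRatio_le hq
  have hC0 : 0 ≤ C := (norm_nonneg _).trans (hC 0 0)
  have hb (M : ℕ) : ‖rogersFineSum q M‖ ≤ C * (1 - ‖q‖)⁻¹ := by
    refine tsum_of_norm_bounded
      ((hasSum_geometric_of_lt_one (norm_nonneg q) hq).mul_left C) fun n ↦ ?_
    rw [norm_mul, norm_pow]
    refine mul_le_mul (hC M n) (pow_le_pow_of_le_one (norm_nonneg _) hq.le ?_) (by positivity) hC0
    nlinarith
  have h1 : Tendsto (fun M : ℕ ↦ (-1) ^ M * q ^ (M ^ 2 + 2 * M) * rogersFineSum q M) atTop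
      (𝓝 0) := by
    have := (tendsto_pow_atTop_nhds_zero_of_lt_one (norm_nonneg q) hq).mul_const
      (C * (1 - ‖q‖)⁻¹)
    rw [zero_mul] at this
    refine squeeze_zero_norm (fun M ↦ ?_) this
    simp only [norm_mul, norm_pow, norm_neg, norm_one, one_pow, one_mul]
    refine mul_le_mul (pow_le_pow_of_le_one (norm_nonneg _) hq.le (by nlinarith)) (hb M)
      (norm_nonneg _) (by positivity)
  have h2 := ((summable_theta hq).of_norm.hasSum.tendsto_sum_nat).sub (h1.const_mul q)
  have h3 : Tendsto (fun _ : ℕ ↦ -(q * rogersFineSum q 0)) atTop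
      (𝓝 (-(q * rogersFineSum q 0))) := tendsto_const_nhds
  have h4 := tendsto_nhds_unique (h3.congr fun M ↦ ?_) h2
  · rw [theta]
    linear_combination (-2) * h4
  · rw [rogersFineSum_zero_eq hq M, mul_add, neg_add, Finset.mul_sum, ← Finset.sum_neg_distrib,
      ← sub_eq_add_neg]
    congr 1
    refine Finset.sum_congr rfl fun j _ ↦ ?_
    ring

theorem prod_eq_one_sub_sum {q : ℂ} (hq : ‖q‖ < 1) (N : ℕ) :
    ∏ i ∈ Finset.range N, (1 - q ^ (i + 1)) / (1 + q ^ (i + 1)) =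
      1 - 2 * q * ∑ n ∈ Finset.range N, pochhammerRatio q 0 n * q ^ ((0 + 1) * n) := by
  induction N with
  | zero => simp
  | succ N ih =>
    have n1 := one_add_pow_ne_zero hq N
    have n4 : ∏ i ∈ Finset.range N, (1 + q ^ (i + 1)) ≠ 0 :=
      Finset.prod_ne_zero_iff.mpr fun i _ ↦ one_add_pow_ne_zero hq _
    rw [Finset.sum_range_succ, mul_add, ← sub_sub, ← ih, Finset.prod_range_succ,
      Finset.prod_div_distrib, pochhammerRatio, Finset.prod_range_succ]
    simp_rw [zero_add, add_comm 1, one_mul]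
    field_simp
    ring

/-- Gauss's identity in the form `genFun = 1 / theta`. -/
theorem genFun_mul_theta {q : ℂ} (hq : ‖q‖ < 1) : genFun q * theta q = 1 := by
  have h1 : Tendsto (fun N ↦ ∏ i ∈ Finset.range N, (1 - q ^ (i + 1)) / (1 + q ^ (i + 1))) atTop
      (𝓝 (theta q)) := by
    simp_rw [prod_eq_one_sub_sum hq, theta_eq hq]
    exact ((summable_pochhammerRatio hq 0).hasSum.tendsto_sum_nat.const_mul _).const_sub _
  refine tendsto_nhds_unique ((tendsto_prod_genFun hq).mul h1) (tendsto_const_nhds.congr fun N ↦ ?_)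
  rw [← Finset.prod_mul_distrib]
  refine (Finset.prod_eq_one fun i _ ↦ ?_).symm
  have n1 := one_add_pow_ne_zero hq i
  have n2 := one_sub_pow_ne_zero hq i
  field_simp

open Complex in
theorem theta_exp_neg_eq_jacobiTheta₂ {s : ℂ} (hs : 0 < s.re) :
    theta (cexp (-s)) = jacobiTheta₂ (1 / 2) (I * s / Real.pi) := by
  have hτ : 0 < (I * s / Real.pi).im := by
    rw [Complex.div_ofReal_im]
    simpa using div_pos hs Real.pi_pos
  have hpi : (Real.pi : ℂ) ≠ 0 := by exact_mod_cast Real.pi_ne_zero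
  have hterm (n : ℤ) : jacobiTheta₂_term n (1 / 2) (I * s / Real.pi) =
      cexp (n * (Real.pi * I)) * cexp (-(n ^ 2 * s)) := by
    rw [jacobiTheta₂_term, ← Complex.exp_add]
    congr 1
    field_simp
    linear_combination (n : ℂ) ^ 2 * s * Complex.I_sq
  have h1 := (hasSum_jacobiTheta₂_term (1 / 2) hτ).nat_add_neg
  have hq : ‖cexp (-s)‖ < 1 := by rw [Complex.norm_exp]; simpa using hs
  have h2 : HasSum (fun j : ℕ ↦ 2 * ((-1) ^ (j + 1) * cexp (-s) ^ (j + 1) ^ 2)) (theta (cexp (-s)) - 1) := by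
    rw [theta, add_sub_cancel_left]
    exact (summable_theta hq).of_norm.hasSum.mul_left 2
  rw [← hasSum_nat_add_iff' 1] at h1
  have h3 := h2.unique (h1.congr_fun ?_)
  · simp only [Finset.range_one, Finset.sum_singleton, Nat.cast_zero, neg_zero, hterm,
      Int.cast_zero, zero_mul, Complex.exp_zero] at h3
    norm_num at h3
    linear_combination h3
  · intro j
    simp only [hterm]
    have e (j : ℕ) : cexp (((j : ℤ) : ℂ) * (Real.pi * I)) = (-1) ^ j := by
      rw [← Complex.exp_pi_mul_I, ← Complex.exp_nat_mul]; push_cast; rfl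
    have e' : cexp (((-((j + 1 : ℕ) : ℤ) : ℤ) : ℂ) * (Real.pi * I)) = (-1) ^ (j + 1) := by
      rw [Int.cast_neg, neg_mul, Complex.exp_neg, e, ← inv_pow]
      norm_num
    rw [e, e', ← Complex.exp_nat_mul]
    push_cast
    ring_nf

/-- The theta series appearing after the modular inversion. -/
noncomputable def dualTheta (s : ℂ) : ℂ :=
  2 * ∑' n : ℕ, Complex.exp (-(Real.pi ^ 2 / s)) ^ (n * (n + 1))

open Complex in
theorem theta_exp_neg {s : ℂ} (hs : 0 < s.re) :
    theta (cexp (-s)) = 1 / (s / Real.pi) ^ (1 / 2 : ℂ) * cexp (-(Real.pi ^ 2 / (4 * s))) *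
      dualTheta s := by
  have hs0 : s ≠ 0 := by rintro rfl; simp at hs
  have hpi : (Real.pi : ℂ) ≠ 0 := by exact_mod_cast Real.pi_ne_zero
  have hI : I ≠ 0 := I_ne_zero
  have hτ : 0 < (-1 / (I * s / Real.pi)).im := by
    have : -1 / (I * s / Real.pi) = I * (Real.pi * s⁻¹) := by
      field_simp
      rw [Complex.I_sq]
    rw [this]
    simp only [I_mul_im, re_ofReal_mul, inv_re]
    have := Complex.normSq_pos.mpr hs0
    have := Real.pi_pos
    positivity
  rw [theta_exp_neg_eq_jacobiTheta₂ hs, jacobiTheta₂_functional_equation]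
  have h_a : -I * (I * s / Real.pi) = s / Real.pi := by
    linear_combination -(s / Real.pi) * Complex.I_sq
  have h_b : -Real.pi * I * (1 / 2) ^ 2 / (I * s / Real.pi) = -((Real.pi : ℂ) ^ 2 / (4 * s)) := by
    field_simp
    norm_num
  rw [h_a, h_b]
  congr 1
  · have h1 := hasSum_jacobiTheta₂_term (1 / 2 / (I * s / Real.pi)) hτ
    rw [← (Equiv.addRight (1 : ℤ)).hasSum_iff] at h1
    have h2 := HasSum.nat_add_neg_add_one h1
    rw [← h2.tsum_eq, dualTheta, ← tsum_mul_left]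
    refine tsum_congr fun n ↦ ?_
    simp only [Function.comp_apply, Equiv.coe_addRight, jacobiTheta₂_term]
    rw [two_mul (cexp _ ^ _), ← Complex.exp_nat_mul]
    congr 2
    all_goals
      push_cast
      field_simp
      ring

theorem norm_dualTheta_sub_two_le {s : ℂ} {ρ : ℝ} (hρ : ρ ≤ 1 / 2)
    (h : ‖Complex.exp (-(Real.pi ^ 2 / s))‖ ≤ ρ) : ‖dualTheta s - 2‖ ≤ 4 * ρ ^ 2 := by
  set u := Complex.exp (-(Real.pi ^ 2 / s))
  have hρ0 : 0 ≤ ρ := (norm_nonneg _).trans h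
  have hρ1 : ρ < 1 := by linarith
  have hb (n : ℕ) : ‖u ^ ((n + 1) * (n + 1 + 1))‖ ≤ ρ ^ 2 * ρ ^ n := by
    rw [norm_pow, ← pow_add]
    refine (pow_le_pow_left₀ (norm_nonneg _) h _).trans (pow_le_pow_of_le_one hρ0 hρ1.le ?_)
    nlinarith
  have hg := (hasSum_geometric_of_lt_one hρ0 hρ1).mul_left (ρ ^ 2)
  have hs1 : Summable fun n : ℕ ↦ u ^ ((n + 1) * (n + 1 + 1)) :=
    hg.summable.of_norm_bounded hb
  have hs : Summable fun n : ℕ ↦ u ^ (n * (n + 1)) :=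
    (summable_nat_add_iff (f := fun n : ℕ ↦ u ^ (n * (n + 1))) 1).mp hs1
  have h1 : dualTheta s - 2 = 2 * ∑' n : ℕ, u ^ ((n + 1) * (n + 1 + 1)) := by
    rw [dualTheta, hs.tsum_eq_zero_add]
    simp
    ring
  rw [h1, norm_mul, Complex.norm_ofNat]
  have h2 := tsum_of_norm_bounded hg hb
  have h3 : (1 - ρ)⁻¹ ≤ 2 := by
    rw [inv_le_comm₀ (by linarith) two_pos]; linarith
  calc _ ≤ 2 * (ρ ^ 2 * (1 - ρ)⁻¹) := by gcongr
    _ ≤ 2 * (ρ ^ 2 * 2) := by gcongr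
    _ = _ := by ring

open Complex in
theorem two_pi_mul_abs_le_norm {s : ℂ} (him : |s.im| ≤ Real.pi) {m : ℤ} (hm : m ≠ 0) :
    Real.pi * |(m : ℝ)| ≤ ‖s - 2 * Real.pi * I * m‖ := by
  refine le_trans ?_ (Complex.abs_im_le_norm _)
  have h1 : (s - 2 * Real.pi * I * m).im = s.im - 2 * Real.pi * m := by simp
  have h2 : (1 : ℝ) ≤ |(m : ℝ)| := by exact_mod_cast Int.one_le_abs hm
  have h3 := abs_sub_abs_le_abs_sub (2 * Real.pi * m) s.im
  rw [abs_mul, abs_of_pos Real.two_pi_pos, abs_sub_comm] at h3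
  rw [h1]
  nlinarith [Real.pi_pos]

open Complex in
theorem lipschitz_formula {s : ℂ} (hs : 0 < s.re) {j : ℕ} (hj : 1 ≤ j) :
    ∑' n : ℕ, (n : ℂ) ^ j * cexp (-s) ^ n =
      j.factorial * ∑' m : ℤ, 1 / (s - 2 * Real.pi * I * m) ^ (j + 1) := by
  have hpi : (Real.pi : ℂ) ≠ 0 := by exact_mod_cast Real.pi_ne_zero
  have hz : 0 < (I * s / (2 * Real.pi)).im := by
    rw [show (2 * Real.pi : ℂ) = ((2 * Real.pi : ℝ) : ℂ) by push_cast; rfl, Complex.div_ofReal_im]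
    simpa using div_pos hs Real.two_pi_pos
  have h := EisensteinSeries.qExpansion_identity hj ⟨_, hz⟩
  have e1 : cexp (2 * Real.pi * I * (I * s / (2 * Real.pi))) = cexp (-s) := by
    congr 1
    field_simp
    rw [Complex.I_sq]; ring
  simp only at h
  rw [e1] at h
  have e2 (m : ℤ) : 1 / (I * s / (2 * Real.pi) + m) ^ (j + 1) =
      (-2 * Real.pi * I) ^ (j + 1) * (1 / (s - 2 * Real.pi * I * m) ^ (j + 1)) := by
    have : I * s / (2 * Real.pi) + m = (s - 2 * Real.pi * I * m) / (-2 * Real.pi * I) := by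
      have := Complex.I_ne_zero
      field_simp
      linear_combination s * Complex.I_sq
    rw [this, div_pow]
    field_simp
  simp only [e2] at h
  rw [tsum_mul_left] at h
  have h0 : (-2 * Real.pi * I : ℂ) ^ (j + 1) ≠ 0 :=
    pow_ne_zero _ (by simp [hpi])
  have h1 : (j.factorial : ℂ) ≠ 0 := by exact_mod_cast j.factorial_ne_zero
  rw [div_mul_eq_mul_div, eq_div_iff h1] at h
  refine mul_left_cancel₀ h0 ?_
  rw [← h]
  ring

open Complex in
theorem norm_tsum_pow_sub_le {s : ℂ} (hs : 0 < s.re) (him : |s.im| ≤ Real.pi) {j : ℕ}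
    (hj : 1 ≤ j) :
    ‖∑' n : ℕ, (n : ℂ) ^ j * cexp (-s) ^ n - j.factorial / s ^ (j + 1)‖ ≤
      j.factorial * (Real.pi ^ 2 / 3 / Real.pi ^ (j + 1)) := by
  set f : ℤ → ℂ := fun m ↦ 1 / (s - 2 * Real.pi * I * m) ^ (j + 1) with hf
  have hb (m : ℤ) (hm : m ≠ 0) : ‖f m‖ ≤ 1 / Real.pi ^ (j + 1) * (1 / (m : ℝ) ^ 2) := by
    have h1 := two_pi_mul_abs_le_norm him hm
    have h2 : (1 : ℝ) ≤ |(m : ℝ)| := by exact_mod_cast Int.one_le_abs hm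
    have hp := Real.pi_pos
    simp only [hf]
    rw [norm_div, norm_one, norm_pow, div_mul_div_comm, one_mul]
    refine one_div_le_one_div_of_le (by positivity) ?_
    calc Real.pi ^ (j + 1) * (m : ℝ) ^ 2 = Real.pi ^ (j + 1) * |(m : ℝ)| ^ 2 := by rw [sq_abs]
      _ ≤ Real.pi ^ (j + 1) * |(m : ℝ)| ^ (j + 1) := by
        gcongr ?_ * ?_
        exact pow_le_pow_right₀ h2 (by omega)
      _ = (Real.pi * |(m : ℝ)|) ^ (j + 1) := (mul_pow _ _ _).symm
      _ ≤ _ := by gcongr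
  have hsum : Summable f := by
    refine Summable.of_norm_bounded_eventually
      (((Real.summable_one_div_int_pow (p := 2)).mpr one_lt_two).mul_left
        (1 / Real.pi ^ (j + 1))) ?_
    filter_upwards [(Set.finite_singleton (0 : ℤ)).compl_mem_cofinite] with m hm
    exact hb m hm
  have h1 := hsum.hasSum.nat_add_neg
  rw [← hasSum_nat_add_iff' 1] at h1
  have hz := (hasSum_nat_add_iff' 1).mpr hasSum_zeta_two
  have h2 := tsum_of_norm_bounded (hz.mul_left (2 / Real.pi ^ (j + 1))) (f := fun n : ℕ ↦
    f ((n + 1 : ℕ) : ℤ) + f (-((n + 1 : ℕ) : ℤ))) (fun n ↦ by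
      refine (norm_add_le _ _).trans ?_
      have e1 := hb ((n + 1 : ℕ) : ℤ) (by positivity)
      have e2 := hb (-((n + 1 : ℕ) : ℤ)) (by rw [neg_ne_zero]; positivity)
      rw [Int.cast_neg, neg_sq] at e2
      rw [Int.cast_natCast] at e1 e2
      calc _ ≤ _ := add_le_add e1 e2
        _ = _ := by ring)
  rw [h1.tsum_eq] at h2
  have h3 : (∑' m, f m) + f 0 - ∑ i ∈ Finset.range 1, (f (i : ℤ) + f (-(i : ℤ))) =
      (∑' m, f m) - 1 / s ^ (j + 1) := by
    simp [hf]
  rw [h3] at h2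
  rw [lipschitz_formula hs hj]
  have h4 : (j.factorial : ℂ) * ∑' m, f m - j.factorial / s ^ (j + 1) =
      j.factorial * (∑' m, f m - 1 / s ^ (j + 1)) := by ring
  rw [h4, norm_mul, Complex.norm_natCast]
  refine mul_le_mul_of_nonneg_left (h2.trans_eq ?_) (Nat.cast_nonneg _)
  simp
  ring

/-- Taylor coefficients of the main term of the overpartition function. -/
noncomputable def mainCoeff (i : ℕ) : ℝ :=
  (i + 2) * Real.pi ^ (2 * (i + 2)) / (2 * (2 * i + 5).factorial)

/-- The main term of the overpartition function, without its constant term. -/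
noncomputable def mainTail (t : ℝ) : ℝ := ∑' i, mainCoeff i * t ^ (i + 1)

/-- The series obtained by applying the leading part of the Lipschitz formula to `mainTail`. -/
noncomputable def mainLaplace (s : ℂ) : ℂ :=
  ∑' i, (mainCoeff i : ℂ) * ((i + 1).factorial / s ^ (i + 2))

theorem mainCoeff_nonneg (i : ℕ) : 0 ≤ mainCoeff i := by
  have := Real.pi_pos
  rw [mainCoeff]; positivity

theorem four_pow_mul_factorial_sq_le (k : ℕ) :
    4 ^ k * k.factorial ^ 2 ≤ (2 * k + 1).factorial := by
  induction k with
  | zero => simp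
  | succ k ih =>
    rw [show 2 * (k + 1) + 1 = (2 * k + 2) + 1 by ring, Nat.factorial_succ (2 * k + 2),
      Nat.factorial_succ (2 * k + 1), Nat.factorial_succ k]
    calc 4 ^ (k + 1) * ((k + 1) * k.factorial) ^ 2
        = (4 * (k + 1) ^ 2) * (4 ^ k * k.factorial ^ 2) := by ring
      _ ≤ (4 * (k + 1) ^ 2) * (2 * k + 1).factorial := by gcongr
      _ ≤ ((2 * k + 3) * (2 * k + 2)) * (2 * k + 1).factorial :=
        Nat.mul_le_mul_right _ (by nlinarith)
      _ = _ := by ring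

theorem mainCoeff_mul_factorial_le (i : ℕ) :
    mainCoeff i * (i + 1).factorial ≤ (Real.pi ^ 2 / 4) ^ (i + 2) / (i + 2).factorial / 2 := by
  have h : (4 : ℝ) ^ (i + 2) * (i + 2).factorial ^ 2 ≤ (2 * i + 5).factorial := by
    exact_mod_cast four_pow_mul_factorial_sq_le (i + 2)
  have hf : ((i + 2).factorial : ℝ) = (i + 2) * (i + 1).factorial := by
    rw [Nat.factorial_succ (i + 1)]; push_cast; ring
  have h0 : (0 : ℝ) < (i + 2).factorial := by exact_mod_cast (i + 2).factorial_pos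
  have h1 : (0 : ℝ) < (2 * i + 5).factorial := by exact_mod_cast (2 * i + 5).factorial_pos
  have hp : 0 < Real.pi ^ (2 * (i + 2)) := pow_pos Real.pi_pos _
  calc mainCoeff i * (i + 1).factorial
      = Real.pi ^ (2 * (i + 2)) * (i + 2).factorial / (2 * (2 * i + 5).factorial) := by
        rw [mainCoeff, hf]; ring
    _ ≤ Real.pi ^ (2 * (i + 2)) * (i + 2).factorial /
        (2 * (4 ^ (i + 2) * (i + 2).factorial ^ 2)) := by gcongr
    _ = _ := by
      rw [div_pow, ← pow_mul]
      field_simp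

theorem tsum_mainCoeff_le {y : ℝ} (hy : 0 ≤ y) :
    (Summable fun i ↦ mainCoeff i * (i + 1).factorial * y ^ (i + 2)) ∧
      ∑' i, mainCoeff i * (i + 1).factorial * y ^ (i + 2) ≤ Real.exp (Real.pi ^ 2 / 4 * y) / 2 := by
  have h := NormedSpace.expSeries_div_hasSum_exp (Real.pi ^ 2 / 4 * y)
  rw [← Real.exp_eq_exp_ℝ] at h
  have hb (i : ℕ) : mainCoeff i * (i + 1).factorial * y ^ (i + 2) ≤
      (Real.pi ^ 2 / 4 * y) ^ (i + 2) / (i + 2).factorial / 2 := by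
    refine (mul_le_mul_of_nonneg_right (mainCoeff_mul_factorial_le i) (by positivity)).trans_eq ?_
    rw [mul_pow]; ring
  have hn (i : ℕ) : 0 ≤ mainCoeff i * (i + 1).factorial * y ^ (i + 2) := by
    have := mainCoeff_nonneg i
    positivity
  have h2 := ((summable_nat_add_iff 2).mpr h.summable).div_const 2
  refine ⟨Summable.of_nonneg_of_le hn hb h2, ?_⟩
  refine (Summable.tsum_le_tsum hb (Summable.of_nonneg_of_le hn hb h2) h2).trans ?_
  rw [tsum_div_const]
  gcongr
  rw [← h.tsum_eq, ← h.summable.sum_add_tsum_nat_add 2]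
  refine le_add_of_nonneg_left (Finset.sum_nonneg fun i _ ↦ by positivity)

theorem norm_mainLaplace_le (s : ℂ) :
    ‖mainLaplace s‖ ≤ Real.exp (Real.pi ^ 2 / (4 * ‖s‖)) / 2 := by
  obtain ⟨h1, h2⟩ := tsum_mainCoeff_le (y := ‖s‖⁻¹) (by positivity)
  refine (tsum_of_norm_bounded h1.hasSum fun i ↦ ?_).trans (h2.trans_eq ?_)
  · rw [norm_mul, norm_div, norm_pow, Complex.norm_natCast, Complex.norm_real,
      Real.norm_of_nonneg (mainCoeff_nonneg i), inv_pow]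
    exact le_of_eq (by ring)
  · congr 2; ring

theorem tsum_pow_mul_exp_le {x : ℝ} (hx : 0 < x) {j : ℕ} (hj : 1 ≤ j) :
    ∑' n : ℕ, (n : ℝ) ^ j * Real.exp (-x) ^ n ≤
      j.factorial * (x⁻¹ ^ (j + 1) + Real.pi ^ 2 / 3 * Real.pi⁻¹ ^ (j + 1)) := by
  have h := norm_tsum_pow_sub_le (s := (x : ℂ)) (by simpa using hx) (by simp [Real.pi_pos.le]) hj
  have e : ∑' n : ℕ, (n : ℂ) ^ j * Complex.exp (-x) ^ n - j.factorial / (x : ℂ) ^ (j + 1) =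
      ((∑' n : ℕ, (n : ℝ) ^ j * Real.exp (-x) ^ n - j.factorial / x ^ (j + 1) : ℝ) : ℂ) := by
    push_cast
    rfl
  rw [e, Complex.norm_real] at h
  have h2 := (le_abs_self _).trans h
  calc _ ≤ j.factorial / x ^ (j + 1) + j.factorial * (Real.pi ^ 2 / 3 / Real.pi ^ (j + 1)) := by
        linarith
    _ = _ := by simp only [inv_pow]; ring

theorem summable_mainTerm_double {x : ℝ} (hx : 0 < x) :
    Summable fun p : ℕ × ℕ ↦ mainCoeff p.1 * (p.2 : ℝ) ^ (p.1 + 1) * Real.exp (-x) ^ p.2 := by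
  have hr : ‖Real.exp (-x)‖ < 1 := by
    rw [Real.norm_of_nonneg (Real.exp_pos _).le, Real.exp_lt_one_iff]; linarith
  rw [summable_prod_of_nonneg fun p ↦ by have := mainCoeff_nonneg p.1; positivity]
  constructor
  · intro i
    simp only [mul_assoc]
    exact (summable_pow_mul_geometric_of_norm_lt_one (i + 1) hr).mul_left _
  · have h1 := (tsum_mainCoeff_le (y := x⁻¹) (by positivity)).1
    have h2 := ((tsum_mainCoeff_le (y := Real.pi⁻¹) (by have := Real.pi_pos; positivity)).1).mul_left
      (Real.pi ^ 2 / 3)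
    refine Summable.of_nonneg_of_le (fun i ↦ tsum_nonneg fun n ↦ ?_) (fun i ↦ ?_) (h1.add h2)
    · have := mainCoeff_nonneg i; positivity
    · simp only [mul_assoc]
      rw [tsum_mul_left]
      refine (mul_le_mul_of_nonneg_left (tsum_pow_mul_exp_le hx (Nat.le_add_left 1 i))
        (mainCoeff_nonneg i)).trans_eq ?_
      ring

theorem summable_mainTail {x : ℝ} (hx : 0 < x) :
    Summable fun n : ℕ ↦ mainTail n * Real.exp (-x) ^ n := by
  have := (summable_mainTerm_double hx).prod_symm.prod
  refine this.congr fun n ↦ ?_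
  rw [mainTail, ← tsum_mul_right]
  rfl

theorem mainTail_nonneg {t : ℝ} (ht : 0 ≤ t) : 0 ≤ mainTail t :=
  tsum_nonneg fun i ↦ by have := mainCoeff_nonneg i; positivity

open Complex in
theorem norm_tsum_mainTail_sub_le {s : ℂ} (hs : 0 < s.re) (him : |s.im| ≤ Real.pi) :
    ‖∑' n : ℕ, (mainTail n : ℂ) * cexp (-s) ^ n - mainLaplace s‖ ≤ 4 := by
  have hnorm : ‖cexp (-s)‖ = Real.exp (-s.re) := by rw [Complex.norm_exp]; simp
  have hS : Summable (Function.uncurry fun i n : ℕ ↦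
      (mainCoeff i : ℂ) * ((n : ℂ) ^ (i + 1) * cexp (-s) ^ n)) := by
    refine ((summable_mainTerm_double hs).congr fun p ↦ ?_).of_norm
    simp only [Function.uncurry, norm_mul, norm_pow, hnorm, Complex.norm_natCast,
      Complex.norm_real, Real.norm_of_nonneg (mainCoeff_nonneg _)]
    ring
  have h1 : ∑' n : ℕ, (mainTail n : ℂ) * cexp (-s) ^ n =
      ∑' i : ℕ, (mainCoeff i : ℂ) * ∑' n : ℕ, (n : ℂ) ^ (i + 1) * cexp (-s) ^ n := by
    simp only [← tsum_mul_left]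
    rw [← hS.tsum_comm]
    refine tsum_congr fun n ↦ ?_
    rw [mainTail, Complex.ofReal_tsum, ← tsum_mul_right]
    refine tsum_congr fun i ↦ ?_
    push_cast
    ring
  have hs0 : s ≠ 0 := by rintro rfl; simp at hs
  have hL : Summable fun i ↦ (mainCoeff i : ℂ) * ((i + 1).factorial / s ^ (i + 2)) := by
    refine ((tsum_mainCoeff_le (y := ‖s‖⁻¹) (by positivity)).1.congr fun i ↦ ?_).of_norm
    rw [norm_mul, norm_div, norm_pow, Complex.norm_natCast, Complex.norm_real,
      Real.norm_of_nonneg (mainCoeff_nonneg i), inv_pow]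
    ring
  obtain ⟨hp1, hp2⟩ := tsum_mainCoeff_le (y := Real.pi⁻¹) (by have := Real.pi_pos; positivity)
  have hF : Summable fun i : ℕ ↦
      (mainCoeff i : ℂ) * ∑' n : ℕ, (n : ℂ) ^ (i + 1) * cexp (-s) ^ n := by
    have := hS.prod
    simp only [Function.uncurry, tsum_mul_left] at this
    exact this
  rw [h1, mainLaplace, ← hF.tsum_sub hL]
  refine (tsum_of_norm_bounded (hp1.mul_left (Real.pi ^ 2 / 3)).hasSum fun i ↦ ?_).trans ?_
  · rw [← mul_sub, norm_mul, Complex.norm_real, Real.norm_of_nonneg (mainCoeff_nonneg _)]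
    refine (mul_le_mul_of_nonneg_left (norm_tsum_pow_sub_le hs him (Nat.le_add_left 1 i))
      (mainCoeff_nonneg i)).trans_eq ?_
    simp only [inv_pow]
    ring
  · rw [tsum_mul_left]
    have e1 : Real.pi ^ 2 / 4 * Real.pi⁻¹ = Real.pi / 4 := by
      have := Real.pi_ne_zero
      field_simp
    rw [e1] at hp2
    have e2 : Real.exp (Real.pi / 4) ≤ 2.2 := by
      have h1 : Real.pi / 4 ≤ 0.78540 := by linarith [Real.pi_lt_d6]
      refine (Real.exp_le_exp.mpr h1).trans ?_
      have h2 := Real.exp_bound' (x := 0.78540) (by norm_num) (by norm_num) (n := 6) (by norm_num)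
      refine h2.trans ?_
      norm_num [Finset.sum_range_succ, Nat.factorial]
    have hpi2 : Real.pi ^ 2 ≤ 9.9 := by nlinarith [Real.pi_lt_d4, Real.pi_pos]
    have h0 : 0 ≤ Real.pi ^ 2 / 3 := by positivity
    calc _ ≤ Real.pi ^ 2 / 3 * (Real.exp (Real.pi / 4) / 2) := by gcongr
      _ ≤ 9.9 / 3 * (2.2 / 2) := by gcongr
      _ ≤ 4 := by norm_num

end Overpartition

namespace Overpartition

open MeasureTheory Set

theorem integrable_cexp_neg_sq_add (c : ℂ) :
    Integrable fun u : ℝ ↦ Complex.exp (-(u : ℂ) ^ 2 + c * u) := by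
  have := integrable_cexp_quadratic (b := 1) (by simp) c 0
  simpa using this

theorem integral_cexp_neg_sq_add (c : ℂ) :
    ∫ u : ℝ, Complex.exp (-(u : ℂ) ^ 2 + c * u) = √Real.pi * Complex.exp (c ^ 2 / 4) := by
  have := integral_cexp_quadratic (b := -1) (by simp) c 0
  simp only [add_zero, neg_mul, one_mul, neg_neg, div_one] at this
  rw [this]
  congr 1
  · rw [Real.sqrt_eq_rpow, Complex.ofReal_cpow Real.pi_pos.le]
    norm_num
  · congr 1; ring

/-- The Laplace transform of the Gaussian on the half line. -/
noncomputable def gaussianLaplace (x : ℂ) : ℂ :=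
  ∫ u in Ioi (0 : ℝ), Complex.exp (-(u : ℂ) ^ 2 + -(2 * x) * u)

theorem gaussianLaplace_add_neg (x : ℂ) :
    gaussianLaplace x + gaussianLaplace (-x) = √Real.pi * Complex.exp (x ^ 2) := by
  have h := integral_cexp_neg_sq_add (-(2 * x))
  rw [← intervalIntegral.integral_Iic_add_Ioi (b := 0)
    (integrable_cexp_neg_sq_add _).integrableOn (integrable_cexp_neg_sq_add _).integrableOn] at h
  have h2 := integral_comp_neg_Iic (0 : ℝ) fun u : ℝ ↦ Complex.exp (-(u : ℂ) ^ 2 + 2 * x * u)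
  simp only [Complex.ofReal_neg, neg_sq, neg_zero, mul_neg] at h2
  simp only [neg_mul] at h
  rw [h2] at h
  simp only [gaussianLaplace, neg_mul, mul_neg, neg_neg]
  rw [add_comm, h]
  congr 2
  ring

theorem norm_gaussianLaplace_le {x : ℂ} (hx : 0 ≤ x.re) :
    ‖gaussianLaplace x‖ ≤ √Real.pi / 2 := by
  have h1 := integral_gaussian_Ioi 1
  rw [div_one] at h1
  rw [← h1]
  refine norm_integral_le_of_norm_le
    (integrable_exp_neg_mul_sq one_pos).integrableOn ?_
  filter_upwards [ae_restrict_mem measurableSet_Ioi] with u hu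
  rw [Complex.norm_exp]
  refine Real.exp_le_exp.mpr ?_
  have hu : 0 < u := hu
  have : (-(u : ℂ) ^ 2 + -(2 * x) * u).re = -1 * u ^ 2 - 2 * x.re * u := by
    rw [Complex.add_re, Complex.re_mul_ofReal,
      show -(u : ℂ) ^ 2 = ((-u ^ 2 : ℝ) : ℂ) by push_cast; rfl, Complex.ofReal_re]
    simp
    ring
  rw [this]
  nlinarith [mul_nonneg hx hu.le]

theorem integral_pow_mul_exp_neg_sq (k : ℕ) :
    IntegrableOn (fun u : ℝ ↦ u ^ (2 * k + 1) * Real.exp (-u ^ 2)) (Ioi 0) ∧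
    ∫ u in Ioi (0 : ℝ), u ^ (2 * k + 1) * Real.exp (-u ^ 2) = k.factorial / 2 := by
  have h1 := integrableOn_rpow_mul_exp_neg_rpow (p := 2) (s := (2 * k + 1 : ℕ))
    (by push_cast; linarith [(Nat.cast_nonneg k : (0 : ℝ) ≤ k)]) two_pos
  have h2 := integral_rpow_mul_exp_neg_rpow (p := 2) (q := (2 * k + 1 : ℕ)) two_pos
    (by push_cast; linarith [(Nat.cast_nonneg k : (0 : ℝ) ≤ k)])
  simp only [Real.rpow_natCast, Real.rpow_two] at h1 h2
  refine ⟨h1, h2.trans ?_⟩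
  have : (((2 * k + 1 : ℕ) : ℝ) + 1) / 2 = k + 1 := by push_cast; ring
  rw [this, Real.Gamma_nat_eq_factorial]
  ring

theorem summable_erf_series {y : ℝ} (hy : 0 ≤ y) :
    Summable fun k : ℕ ↦ (k.factorial : ℝ) * 4 ^ k * y ^ (2 * k + 1) / (2 * k + 1).factorial := by
  have h := (Real.summable_pow_div_factorial (y ^ 2)).mul_left y
  refine Summable.of_nonneg_of_le (fun k ↦ by positivity) (fun k ↦ ?_) h
  have h1 : (4 : ℝ) ^ k * k.factorial ^ 2 ≤ (2 * k + 1).factorial := by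
    exact_mod_cast four_pow_mul_factorial_sq_le k
  have h0 : (0 : ℝ) < k.factorial := by exact_mod_cast k.factorial_pos
  calc _ ≤ (k.factorial : ℝ) * 4 ^ k * y ^ (2 * k + 1) / (4 ^ k * k.factorial ^ 2) := by gcongr
    _ = _ := by field_simp; ring

theorem hasSum_erf_series (x : ℂ) :
    HasSum (fun k : ℕ ↦ (k.factorial : ℂ) * 4 ^ k * x ^ (2 * k + 1) / (2 * k + 1).factorial)
      ((gaussianLaplace (-x) - gaussianLaplace x) / 2) := by
  set F : ℕ → ℝ → ℂ := fun k u ↦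
    ((2 * x) ^ (2 * k + 1) / (2 * k + 1).factorial) * ((u ^ (2 * k + 1) * Real.exp (-u ^ 2) : ℝ) : ℂ)
    with hF
  have hFi (k : ℕ) : Integrable (F k) (volume.restrict (Ioi 0)) :=
    ((integral_pow_mul_exp_neg_sq k).1.ofReal).const_mul _
  have hval (k : ℕ) : ∫ u in Ioi (0 : ℝ), F k u =
      (k.factorial : ℂ) * 4 ^ k * x ^ (2 * k + 1) / (2 * k + 1).factorial := by
    simp only [hF]
    rw [integral_const_mul, integral_complex_ofReal, (integral_pow_mul_exp_neg_sq k).2]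
    push_cast
    rw [mul_pow, pow_succ 2, pow_mul 2]
    ring
  have hnorm (k : ℕ) : ∫ u in Ioi (0 : ℝ), ‖F k u‖ =
      (k.factorial : ℝ) * 4 ^ k * ‖x‖ ^ (2 * k + 1) / (2 * k + 1).factorial := by
    have : ∀ u ∈ Ioi (0 : ℝ), ‖F k u‖ =
        ‖2 * x‖ ^ (2 * k + 1) / (2 * k + 1).factorial * (u ^ (2 * k + 1) * Real.exp (-u ^ 2)) := by
      intro u hu
      have hu : 0 < u := hu
      simp only [hF]
      rw [norm_mul, norm_div, norm_pow, Complex.norm_natCast, Complex.norm_real,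
        Real.norm_of_nonneg (by positivity)]
    rw [setIntegral_congr_fun measurableSet_Ioi this, integral_const_mul,
      (integral_pow_mul_exp_neg_sq k).2, norm_mul, Complex.norm_ofNat, mul_pow, pow_succ 2,
      pow_mul 2]
    ring
  have h := hasSum_integral_of_summable_integral_norm hFi
    (by simp only [hnorm]; exact summable_erf_series (norm_nonneg x))
  simp only [hval] at h
  convert! h using 1
  rw [gaussianLaplace, gaussianLaplace, ← integral_sub
    (integrable_cexp_neg_sq_add _).integrableOn (integrable_cexp_neg_sq_add _).integrableOn,
    ← integral_div]
  refine integral_congr_ae (ae_of_all _ fun u ↦ ?_)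
  have h1 := ((Complex.hasSum_sinh (2 * x * u)).mul_right (Complex.exp (-(u : ℂ) ^ 2))).tsum_eq
  have h2 : ∑' k, F k u = Complex.sinh (2 * x * u) * Complex.exp (-(u : ℂ) ^ 2) := by
    rw [← h1]
    refine tsum_congr fun k ↦ ?_
    simp only [hF]
    push_cast
    rw [mul_pow (2 * x) (u : ℂ)]
    ring
  simp only [h2, Complex.sinh]
  rw [Complex.exp_add, Complex.exp_add]
  ring_nf

theorem norm_main_sub_mainLaplace_le {s x : ℂ} (hs : s ≠ 0) (hx : 0 ≤ x.re)
    (hxs : x ^ 2 = Real.pi ^ 2 / (4 * s)) :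
    ‖√Real.pi / (4 * x) * Complex.exp (x ^ 2) - mainLaplace s‖ ≤
      √Real.pi / (4 * ‖x‖) + 1 / 2 + ‖x‖ ^ 2 / 3 := by
  have hpi : (Real.pi : ℂ) ≠ 0 := by exact_mod_cast Real.pi_ne_zero
  have hx0 : x ≠ 0 := by
    rintro rfl
    have : (Real.pi : ℂ) ^ 2 / (4 * s) ≠ 0 :=
      div_ne_zero (pow_ne_zero _ hpi) (mul_ne_zero (by norm_num) hs)
    exact this (by rw [← hxs]; simp)
  have h1 := (hasSum_nat_add_iff' 2).mpr (hasSum_erf_series x)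
  have h2 : mainLaplace s = ∑' i : ℕ, ((i + 2).factorial : ℂ) * 4 ^ (i + 2) *
      x ^ (2 * (i + 2) + 1) / (2 * (i + 2) + 1).factorial * (1 / (2 * x)) := by
    rw [mainLaplace]
    refine tsum_congr fun i ↦ ?_
    have e : (4 : ℂ) ^ (i + 2) * x ^ (2 * (i + 2) + 1) =
        (Real.pi : ℂ) ^ (2 * (i + 2)) / s ^ (i + 2) * x := by
      rw [pow_succ x, pow_mul x, ← mul_assoc, ← mul_pow, hxs, pow_mul (Real.pi : ℂ), ← div_pow]
      congr 2
      field_simp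
    rw [mul_assoc _ ((4 : ℂ) ^ _), e, mainCoeff, show 2 * (i + 2) + 1 = 2 * i + 5 by ring,
      Nat.factorial_succ (i + 1)]
    push_cast
    field_simp
    ring
  have h3 := (h1.mul_right (1 / (2 * x))).tsum_eq
  rw [← h2] at h3
  have h4 := gaussianLaplace_add_neg x
  have h5 : √Real.pi / (4 * x) * Complex.exp (x ^ 2) - mainLaplace s =
      gaussianLaplace x / (2 * x) + (1 / 2 + x ^ 2 / 3) := by
    rw [h3]
    simp only [Finset.sum_range_succ, Finset.sum_range_zero]
    norm_num [Nat.factorial]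
    field_simp
    linear_combination (-72) * h4
  rw [h5]
  have hn : 0 < ‖x‖ := norm_pos_iff.mpr hx0
  calc _ ≤ ‖gaussianLaplace x / (2 * x)‖ + ‖1 / 2 + x ^ 2 / 3‖ := norm_add_le _ _
    _ ≤ ‖gaussianLaplace x / (2 * x)‖ + (‖(1 / 2 : ℂ)‖ + ‖x ^ 2 / 3‖) := by
      gcongr; exact norm_add_le _ _
    _ = ‖gaussianLaplace x‖ / (2 * ‖x‖) + (1 / 2 + ‖x‖ ^ 2 / 3) := by simp
    _ ≤ √Real.pi / 2 / (2 * ‖x‖) + (1 / 2 + ‖x‖ ^ 2 / 3) := by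
      gcongr; exact norm_gaussianLaplace_le hx
    _ = _ := by ring

open Complex in
theorem integral_exp_int_mul_I (k : ℤ) :
    ∫ θ in (-Real.pi)..Real.pi, cexp (k * I * θ) = if k = 0 then 2 * (Real.pi : ℂ) else 0 := by
  split_ifs with hk
  · subst hk
    simp
    ring
  · rw [integral_exp_mul_complex (mul_ne_zero (by exact_mod_cast hk) I_ne_zero), div_eq_zero_iff]
    left
    rw [sub_eq_zero, Complex.exp_eq_exp_iff_exists_int]
    exact ⟨k, by push_cast; ring⟩

open Complex in
theorem norm_coeff_le_of_norm_tsum_le {a : ℕ → ℂ} {δ B : ℝ}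
    (ha : Summable fun m ↦ ‖a m‖ * Real.exp (-δ) ^ m)
    (hB : ∀ θ : ℝ, |θ| ≤ Real.pi → ‖∑' m, a m * cexp (-(δ - θ * I)) ^ m‖ ≤ B) (n : ℕ) :
    ‖a n‖ ≤ B * Real.exp (δ * n) := by
  have hpi := Real.pi_pos
  set F : ℕ → ℝ → ℂ := fun m θ ↦ a m * cexp (-(δ - θ * I)) ^ m * cexp (-(n * I * θ)) with hF
  have hF2 (m : ℕ) (θ : ℝ) : F m θ =
      a m * (Real.exp (-δ) ^ m : ℝ) * cexp (((m - n : ℤ) : ℂ) * I * θ) := by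
    simp only [hF]
    rw [mul_assoc (a m), mul_assoc (a m)]
    congr 1
    push_cast
    rw [← Complex.exp_nat_mul, ← Complex.exp_nat_mul, ← Complex.exp_add, ← Complex.exp_add]
    congr 1
    ring
  have hFn (m : ℕ) (θ : ℝ) : ‖F m θ‖ = ‖a m‖ * Real.exp (-δ) ^ m := by
    rw [hF2, norm_mul, norm_mul, Complex.norm_real, Real.norm_of_nonneg (by positivity),
      show (((m - n : ℤ) : ℂ) * I * θ) = (((m - n : ℤ) : ℝ) * θ : ℝ) * I by push_cast; ring,
      Complex.norm_exp_ofReal_mul_I, mul_one]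
  have hcont (m : ℕ) : Continuous (F m) := by
    simp only [hF]; fun_prop
  have hint (m : ℕ) : Integrable (F m) (volume.restrict (Ioc (-Real.pi) Real.pi)) :=
    (hcont m).integrableOn_Ioc
  have h := hasSum_integral_of_summable_integral_norm hint
    (by
      simp only [hFn]
      simpa using ha.mul_left _)
  have hval (m : ℕ) : ∫ θ in Ioc (-Real.pi) Real.pi, F m θ =
      if m = n then a m * (Real.exp (-δ) ^ m : ℝ) * (2 * Real.pi) else 0 := by
    rw [← intervalIntegral.integral_of_le (by linarith)]
    simp only [hF2]
    rw [intervalIntegral.integral_const_mul, integral_exp_int_mul_I]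
    have : ((m : ℤ) - n = 0) ↔ m = n := by omega
    simp only [this]
    split_ifs <;> simp
  simp only [hval] at h
  have h2 := (hasSum_ite_eq n (a n * (Real.exp (-δ) ^ n : ℝ) * (2 * Real.pi))).unique
    (h.congr_fun fun m ↦ by
      by_cases hm : m = n
      · subst hm; simp
      · simp [hm])
  rw [← intervalIntegral.integral_of_le (by linarith)] at h2
  have h3 : ‖∫ θ in (-Real.pi)..Real.pi, ∑' m, F m θ‖ ≤ B * |Real.pi - -Real.pi| := by
    refine intervalIntegral.norm_integral_le_of_norm_le_const fun θ hθ ↦ ?_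
    rw [uIoc_of_le (by linarith)] at hθ
    simp only [hF]
    rw [tsum_mul_right, norm_mul, show -(n * I * θ) = ((-(n * θ) : ℝ) : ℂ) * I by push_cast; ring,
      Complex.norm_exp_ofReal_mul_I, mul_one]
    exact hB θ (abs_le.mpr ⟨hθ.1.le, hθ.2⟩)
  rw [← h2, norm_mul, norm_mul, Complex.norm_real, Real.norm_of_nonneg (by positivity),
    show Real.pi - -Real.pi = 2 * Real.pi by ring, abs_of_pos (by positivity),
    show (2 * Real.pi : ℂ) = ((2 * Real.pi : ℝ) : ℂ) by push_cast; rfl, Complex.norm_real,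
    Real.norm_of_nonneg (by positivity), mul_le_mul_iff_left₀ (by positivity), ← Real.exp_nat_mul,
    ← le_div_iff₀ (Real.exp_pos _), div_eq_mul_inv, ← Real.exp_neg] at h3
  refine h3.trans_eq ?_
  congr 2
  ring

end Overpartition

namespace Overpartition

theorem pi_sq_lt : Real.pi ^ 2 < 9.8697 := by nlinarith [Real.pi_lt_d6, Real.pi_pos]

theorem re_cpow_half_pos {z : ℂ} (hz : 0 < z.re) : 0 < (z ^ (1 / 2 : ℂ)).re := by
  have hz0 : z ≠ 0 := by rintro rfl; simp at hz
  have h := Complex.abs_arg_lt_pi_div_two_iff.mpr (Or.inl hz)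
  rw [abs_lt] at h
  rw [Complex.cpow_def_of_ne_zero hz0, Complex.exp_re]
  refine mul_pos (Real.exp_pos _) (Real.cos_pos_of_mem_Ioo ?_)
  have : (Complex.log z * (1 / 2)).im = z.arg / 2 := by
    rw [show (1 / 2 : ℂ) = ((1 / 2 : ℝ) : ℂ) by push_cast; rfl, Complex.im_mul_ofReal,
      Complex.log_im]
    ring
  rw [this]
  constructor <;> linarith [Real.pi_pos]

open Complex in
theorem genFun_exp_neg {s : ℂ} (hs : 0 < s.re) :
    genFun (cexp (-s)) * dualTheta s =
      (s / Real.pi) ^ (1 / 2 : ℂ) * cexp (Real.pi ^ 2 / (4 * s)) := by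
  have hq : ‖cexp (-s)‖ < 1 := by rw [Complex.norm_exp]; simpa using hs
  have h := genFun_mul_theta hq
  have hsp : 0 < (s / Real.pi).re := by
    rw [Complex.div_ofReal_re]; exact div_pos hs Real.pi_pos
  have hw : (s / Real.pi) ^ (1 / 2 : ℂ) ≠ 0 := by
    intro h0
    have := re_cpow_half_pos hsp
    rw [h0] at this
    simp at this
  rw [theta_exp_neg hs, Complex.exp_neg (Real.pi ^ 2 / (4 * s))] at h
  have := Complex.exp_ne_zero (Real.pi ^ 2 / (4 * s))
  field_simp at h
  rw [mul_comm (4 : ℂ) s]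
  exact h

open Complex in
theorem norm_genFun_sub_le_of_major {δ θ : ℝ} (hδ : 0 < δ) (hδ' : δ ≤ 1 / 20)
    (hθ : |θ| ≤ 4 * Real.pi * δ) :
    ‖genFun (cexp (-(δ - θ * I))) - mainLaplace (δ - θ * I)‖ ≤ 3 + 1 / δ := by
  set s : ℂ := δ - θ * I with hsdef
  have hpi := Real.pi_pos
  have hpi2 := pi_sq_lt
  have hre : s.re = δ := by simp [hsdef]
  have him : s.im = -θ := by simp [hsdef]
  have hs : 0 < s.re := by rwa [hre]
  have hs0 : s ≠ 0 := by rintro h; rw [h] at hs; simp at hs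
  have hsp : 0 < (s / Real.pi).re := by
    rw [Complex.div_ofReal_re]; exact div_pos hs Real.pi_pos
  have hnsq : Complex.normSq s ≤ 159 * δ ^ 2 := by
    rw [Complex.normSq_apply, hre, him]
    have : θ ^ 2 ≤ (4 * Real.pi * δ) ^ 2 := sq_le_sq' (abs_le.mp hθ).1 (abs_le.mp hθ).2
    nlinarith [sq_nonneg δ]
  have hnsq0 : 0 < Complex.normSq s := Complex.normSq_pos.mpr hs0
  have hns : ‖s‖ ≤ 13 * δ := by
    rw [← abs_of_nonneg (norm_nonneg s), ← abs_of_pos (by positivity : 0 < 13 * δ)]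
    rw [← sq_le_sq, ← Complex.normSq_eq_norm_sq]
    nlinarith
  have hns' : δ ≤ ‖s‖ := by
    rw [← hre]; exact (le_abs_self _).trans (Complex.abs_re_le_norm s)
  have hre2 : ((Real.pi : ℂ) ^ 2 / s).re = Real.pi ^ 2 * (δ / Complex.normSq s) := by
    rw [div_eq_mul_inv, ← Complex.ofReal_pow, Complex.re_ofReal_mul, Complex.inv_re, hre]
  have hlow : 1 ≤ ((Real.pi : ℂ) ^ 2 / s).re := by
    rw [hre2, ← mul_div_assoc, le_div_iff₀ hnsq0]
    have : 9 ≤ Real.pi ^ 2 := by nlinarith [Real.pi_gt_three]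
    nlinarith [mul_le_mul_of_nonneg_right this hδ.le]
  set u := cexp (-(Real.pi ^ 2 / s)) with hu
  set e := cexp (Real.pi ^ 2 / (4 * s)) with he
  set w := (s / Real.pi) ^ (1 / 2 : ℂ) with hw
  have hρ : ‖u‖ ≤ 1 / 2 := by
    rw [hu, Complex.norm_exp, Complex.neg_re]
    calc Real.exp (-_) ≤ Real.exp (-1) := Real.exp_le_exp.mpr (by linarith)
      _ ≤ 1 / 2 := by linarith [Real.exp_neg_one_lt_half]
  have hρ0 := norm_nonneg u
  have hd := norm_dualTheta_sub_two_le hρ (le_refl ‖u‖)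
  have hd1 : 1 ≤ ‖dualTheta s‖ := by
    have h1 := norm_sub_norm_le (2 : ℂ) (dualTheta s)
    rw [norm_sub_rev, Complex.norm_ofNat] at h1
    nlinarith
  have heu : ‖e‖ ^ 4 * ‖u‖ = 1 := by
    rw [← norm_pow, ← norm_mul, he, hu, ← Complex.exp_nat_mul, ← Complex.exp_add]
    rw [show ((4 : ℕ) : ℂ) * (Real.pi ^ 2 / (4 * s)) + -(Real.pi ^ 2 / s) = 0 by
      push_cast; field_simp; ring]
    simp
  have he1 : 1 ≤ ‖e‖ := by
    by_contra! hlt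
    have : ‖e‖ ^ 4 ≤ 1 := pow_le_one₀ (norm_nonneg _) hlt.le
    nlinarith
  have heu2 : ‖e‖ * ‖u‖ ^ 2 ≤ 1 := by
    have : ‖e‖ ≤ ‖e‖ ^ 4 := le_self_pow₀ he1 (by norm_num)
    nlinarith [mul_nonneg hρ0 hρ0]
  have hw2 : w ^ 2 = s / Real.pi := by
    rw [hw, show (1 / 2 : ℂ) = ((2 : ℕ) : ℂ)⁻¹ by norm_num, Complex.cpow_nat_inv_pow _ two_ne_zero]
  have hwre := re_cpow_half_pos hsp
  rw [← hw] at hwre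
  have hw0 : w ≠ 0 := by rintro h; rw [h] at hwre; simp at hwre
  have hwn : ‖w‖ ≤ 1 / 2 := by
    have h1 : ‖w‖ ^ 2 ≤ 1 / 4 := by
      rw [← norm_pow, hw2, norm_div, Complex.norm_real, Real.norm_of_nonneg hpi.le,
        div_le_iff₀ hpi]
      nlinarith [Real.pi_gt_three]
    nlinarith [norm_nonneg w]
  have hwn0 : 0 < ‖w‖ := norm_pos_iff.mpr hw0
  have hsqrt : ((√Real.pi : ℝ) : ℂ) ≠ 0 := by
    exact_mod_cast (Real.sqrt_pos.mpr hpi).ne'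
  have hsq : ((√Real.pi : ℝ) : ℂ) ^ 2 = Real.pi := by
    rw [← Complex.ofReal_pow, Real.sq_sqrt hpi.le]
  have hpiC : (Real.pi : ℂ) ≠ 0 := by exact_mod_cast hpi.ne'
  set x : ℂ := √Real.pi / (2 * w) with hx
  have hxs : x ^ 2 = Real.pi ^ 2 / (4 * s) := by
    rw [hx, div_pow, mul_pow, hsq, hw2]
    field_simp
    norm_num
  have hxre : 0 ≤ x.re := by
    rw [hx, div_eq_mul_inv, Complex.re_ofReal_mul, mul_inv,
      show (2 : ℂ)⁻¹ = ((2⁻¹ : ℝ) : ℂ) by push_cast; rfl, Complex.re_ofReal_mul, Complex.inv_re]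
    have := Complex.normSq_nonneg w
    positivity
  have hxn : ‖x‖ = √Real.pi / (2 * ‖w‖) := by
    rw [hx, norm_div, norm_mul, Complex.norm_ofNat, Complex.norm_real,
      Real.norm_of_nonneg (Real.sqrt_nonneg _)]
  have hmain := norm_main_sub_mainLaplace_le hs0 hxre hxs
  have hf : √Real.pi / (4 * x) * cexp (x ^ 2) = w / 2 * e := by
    rw [hxs, ← he, hx]
    congr 1
    field_simp
    norm_num
  rw [hf] at hmain
  have hb1 : √Real.pi / (4 * ‖x‖) ≤ 1 / 4 := by
    have : √Real.pi / (4 * ‖x‖) = ‖w‖ / 2 := by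
      have := Real.sqrt_pos.mpr hpi
      rw [hxn]; field_simp; norm_num
    linarith
  have hb2 : ‖x‖ ^ 2 / 3 ≤ 1 / δ := by
    rw [← norm_pow, hxs, norm_div, norm_mul, norm_pow, Complex.norm_real,
      Real.norm_of_nonneg hpi.le, Complex.norm_ofNat, div_div]
    refine (div_le_div_iff₀ (by positivity) hδ).mpr ?_
    nlinarith
  have hdual0 : dualTheta s ≠ 0 := by rintro h; rw [h] at hd1; norm_num at hd1
  have hP : genFun (cexp (-s)) - w / 2 * e = -(w * e * (dualTheta s - 2) / (2 * dualTheta s)) := by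
    have h1 := genFun_exp_neg hs
    rw [← hw, ← he] at h1
    rw [eq_div_of_mul_eq hdual0 h1]
    field_simp
    ring
  have hPn : ‖genFun (cexp (-s)) - w / 2 * e‖ ≤ 1 := by
    rw [hP, norm_neg, norm_div, norm_mul, norm_mul, norm_mul, Complex.norm_ofNat]
    rw [div_le_one (by positivity)]
    calc ‖w‖ * ‖e‖ * ‖dualTheta s - 2‖ ≤ 1 / 2 * ‖e‖ * (4 * ‖u‖ ^ 2) := by gcongr
      _ = 2 * (‖e‖ * ‖u‖ ^ 2) := by ring
      _ ≤ 2 * 1 := by gcongr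
      _ ≤ 2 * ‖dualTheta s‖ := by gcongr
  calc _ = ‖(genFun (cexp (-s)) - w / 2 * e) + (w / 2 * e - mainLaplace s)‖ := by ring_nf
    _ ≤ _ := norm_add_le _ _
    _ ≤ 1 + (1 / 4 + 1 / 2 + 1 / δ) := by
      refine add_le_add hPn (hmain.trans ?_)
      gcongr
    _ ≤ _ := by linarith

open Complex in
theorem two_mul_abs_div_pi_le {δ θ : ℝ} (hθ : |θ| ≤ Real.pi) :
    2 * |θ| / Real.pi * Real.exp (δ / 2) ≤ ‖cexp (δ - θ * I) - 1‖ := by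
  have hpi := Real.pi_pos
  have h1 := Real.mul_le_sin (x := |θ| / 2) (by positivity) (by linarith)
  rw [← abs_of_nonneg (norm_nonneg (cexp _ - 1))]
  refine abs_le_of_sq_le_sq' ?_ (norm_nonneg _) |>.2 |>.trans (le_abs_self _)
  rw [← Complex.normSq_eq_norm_sq, Complex.normSq_apply]
  have hre : (cexp (δ - θ * I) - 1).re = Real.exp δ * Real.cos θ - 1 := by
    simp [Complex.exp_re]
  have him : (cexp (δ - θ * I) - 1).im = -(Real.exp δ * Real.sin θ) := by
    simp [Complex.exp_im]
  rw [hre, him]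
  have h2 : Real.cos θ = 1 - 2 * Real.sin (|θ| / 2) ^ 2 := by
    rw [← Real.cos_abs, show |θ| = 2 * (|θ| / 2) by ring, Real.cos_two_mul, ← mul_div_assoc,
      mul_div_cancel_left₀ _ two_ne_zero]
    linarith [Real.sin_sq_add_cos_sq (|θ| / 2)]
  have h3 : (2 * |θ| / Real.pi) ^ 2 ≤ 4 * Real.sin (|θ| / 2) ^ 2 := by
    have : 2 * |θ| / Real.pi = 2 * (2 / Real.pi * (|θ| / 2)) := by ring
    rw [this, mul_pow]
    have : 0 ≤ 2 / Real.pi * (|θ| / 2) := by positivity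
    nlinarith
  have h4 : Real.exp (δ / 2) ^ 2 = Real.exp δ := by rw [← Real.exp_nat_mul]; congr 1; push_cast; ring
  rw [mul_pow, h4]
  have h5 := Real.exp_pos δ
  have h6 := Real.sin_sq_add_cos_sq θ
  have h7 : (Real.exp δ * Real.cos θ - 1) * (Real.exp δ * Real.cos θ - 1) +
      -(Real.exp δ * Real.sin θ) * -(Real.exp δ * Real.sin θ) =
      (Real.exp δ - 1) ^ 2 + Real.exp δ * (4 * Real.sin (|θ| / 2) ^ 2) := by
    have : Real.sin (|θ| / 2) ^ 2 = (1 - Real.cos θ) / 2 := by linarith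
    rw [this]
    linear_combination Real.exp δ ^ 2 * h6
  rw [h7]
  nlinarith [sq_nonneg (Real.exp δ - 1), mul_le_mul_of_nonneg_left h3 h5.le]

open Complex in
theorem norm_genFun_sub_le_of_minor {δ θ : ℝ} (hδ : 0 < δ) (hθ : |θ| ≤ Real.pi)
    (hθ' : 4 * Real.pi * δ ≤ |θ|) :
    ‖genFun (cexp (-(δ - θ * I))) - mainLaplace (δ - θ * I)‖ ≤
      3 / 2 * Real.exp (0.7175 / δ) := by
  set s : ℂ := δ - θ * I with hsdef
  have hpi := Real.pi_pos
  have hpi2 := pi_sq_lt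
  have hre : s.re = δ := by simp [hsdef]
  have him : s.im = -θ := by simp [hsdef]
  have hn : ‖cexp (-s)‖ = Real.exp (-δ) := by rw [Complex.norm_exp]; simp [hre]
  have h1 := norm_genFun_le hδ hn
  have h2 : 8 * δ ≤ ‖cexp s - 1‖ := by
    refine le_trans ?_ (two_mul_abs_div_pi_le (δ := δ) hθ)
    have h3 : 1 ≤ Real.exp (δ / 2) := Real.one_le_exp (by positivity)
    have h4 : 8 * δ ≤ 2 * |θ| / Real.pi := by
      rw [le_div_iff₀ hpi]; nlinarith
    nlinarith
  have h3 : ‖cexp (-s) / (1 - cexp (-s))‖ ≤ 1 / (8 * δ) := by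
    have : cexp (-s) / (1 - cexp (-s)) = 1 / (cexp s - 1) := by
      have h0 := Complex.exp_ne_zero s
      rw [Complex.exp_neg, ← mul_div_mul_left 1 _ (inv_ne_zero h0), mul_one, mul_sub,
        inv_mul_cancel₀ h0, mul_one]
    rw [this, norm_div, norm_one]
    exact one_div_le_one_div_of_le (by positivity) h2
  have h4 : ‖genFun (cexp (-s))‖ ≤ Real.exp (0.7175 / δ) := by
    refine h1.trans (Real.exp_le_exp.mpr ?_)
    calc _ ≤ 2 * (1 / (8 * δ)) + (9.8697 / 4 - 2) / δ := by gcongr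
      _ = (1 / 4 + (9.8697 / 4 - 2)) / δ := by field_simp; ring
      _ ≤ _ := by gcongr; norm_num
  have h5 : ‖mainLaplace s‖ ≤ Real.exp (0.7175 / δ) / 2 := by
    refine (norm_mainLaplace_le s).trans ?_
    have h6 : |θ| ≤ ‖s‖ := by
      have := Complex.abs_im_le_norm s
      rwa [him, abs_neg] at this
    gcongr Real.exp ?_ / 2
    calc Real.pi ^ 2 / (4 * ‖s‖) ≤ Real.pi ^ 2 / (4 * (4 * Real.pi * δ)) := by
          gcongr; exact hθ'.trans h6
      _ = Real.pi / 16 / δ := by field_simp; norm_num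
      _ ≤ _ := by gcongr; linarith [Real.pi_lt_four]
  refine (norm_sub_le _ _).trans ?_
  linarith

open Complex in
theorem abs_overpartitionFn_sub_mainTail_le {n : ℕ} (hn : 1000 ≤ n) :
    |(overpartitionFn n : ℝ) - mainTail n| ≤ 2 * Real.exp (2.028 * √n) := by
  have hpi := Real.pi_pos
  have hnR : (1000 : ℝ) ≤ n := by exact_mod_cast hn
  have hsn : (31.6 : ℝ) ≤ √n := by
    rw [Real.le_sqrt' (by norm_num)]; linarith
  have hsn0 : 0 < √(n : ℝ) := by linarith
  set δ : ℝ := Real.pi / (2 * √n) with hδdef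
  have hδ : 0 < δ := by positivity
  have hδ' : δ ≤ 1 / 20 := by
    rw [hδdef, div_le_div_iff₀ (by positivity) (by norm_num)]
    linarith [Real.pi_lt_d2]
  set a : ℕ → ℂ := fun m ↦ ((overpartitionFn m - mainTail m : ℝ) : ℂ) with ha
  have hs1 := summable_overpartition hδ
  have hs2 := summable_mainTail hδ
  have hsum : Summable fun m ↦ ‖a m‖ * Real.exp (-δ) ^ m := by
    refine Summable.of_nonneg_of_le (fun m ↦ by positivity) (fun m ↦ ?_) (hs1.add hs2)
    rw [← add_mul, ha, Complex.norm_real]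
    gcongr
    refine (norm_sub_le _ _).trans_eq ?_
    rw [Real.norm_of_nonneg (by positivity),
      Real.norm_of_nonneg (mainTail_nonneg (Nat.cast_nonneg m))]
  have hlarge : 30 ≤ Real.exp (0.7175 / δ) / 2 - 1 / δ := by
    have h1 : 20 ≤ 1 / δ := by rw [le_div_iff₀ hδ]; linarith
    have h2 : 14.35 + 0.7175 * (1 / δ - 20) = 0.7175 / δ := by ring
    have h3 : Real.exp 14.35 * (1 + 0.7175 * (1 / δ - 20)) ≤ Real.exp (0.7175 / δ) := by
      rw [← h2, Real.exp_add]
      gcongr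
      linarith [Real.add_one_le_exp (0.7175 * (1 / δ - 20))]
    have h4 : (2.7 : ℝ) ^ 14 ≤ Real.exp 14.35 := by
      calc (2.7 : ℝ) ^ 14 ≤ Real.exp 1 ^ 14 := by
            gcongr; linarith [Real.exp_one_gt_d9]
        _ = Real.exp 14 := by rw [← Real.exp_nat_mul]; norm_num
        _ ≤ _ := Real.exp_le_exp.mpr (by norm_num)
    have h5 : (1000 : ℝ) ≤ Real.exp 14.35 := le_trans (by norm_num) h4
    nlinarith
  have hB (θ : ℝ) (hθ : |θ| ≤ Real.pi) :
      ‖∑' m, a m * cexp (-(δ - θ * I)) ^ m‖ ≤ 2 * Real.exp (0.7175 / δ) := by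
    set s : ℂ := δ - θ * I with hsdef
    have hre : s.re = δ := by simp [hsdef]
    have him : s.im = -θ := by simp [hsdef]
    have hnorm : ‖cexp (-s)‖ = Real.exp (-δ) := by rw [Complex.norm_exp]; simp [hre]
    have h1 : Summable fun m : ℕ ↦ (overpartitionFn m : ℂ) * cexp (-s) ^ m := by
      refine Summable.of_norm (hs1.congr fun m ↦ ?_)
      rw [norm_mul, norm_pow, hnorm, Complex.norm_natCast]
    have h2 : Summable fun m : ℕ ↦ (mainTail m : ℂ) * cexp (-s) ^ m := by
      refine Summable.of_norm (hs2.congr fun m ↦ ?_)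
      rw [norm_mul, norm_pow, hnorm, Complex.norm_real,
        Real.norm_of_nonneg (mainTail_nonneg (Nat.cast_nonneg m))]
    have h3 : ∑' m, a m * cexp (-s) ^ m =
        genFun (cexp (-s)) - ∑' m : ℕ, (mainTail m : ℂ) * cexp (-s) ^ m := by
      rw [genFun, ← h1.tsum_sub h2]
      refine tsum_congr fun m ↦ ?_
      simp only [ha]
      push_cast
      ring
    have h4 := norm_tsum_mainTail_sub_le (s := s) (by rwa [hre]) (by rwa [him, abs_neg])
    have h5 : ‖genFun (cexp (-s)) - mainLaplace s‖ ≤ 2 * Real.exp (0.7175 / δ) - 4 := by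
      have h0 : 0 < 1 / δ := by positivity
      rcases le_total |θ| (4 * Real.pi * δ) with h | h
      · refine (norm_genFun_sub_le_of_major hδ hδ' h).trans ?_
        linarith
      · refine (norm_genFun_sub_le_of_minor hδ hθ h).trans ?_
        linarith
    rw [h3, ← sub_sub_sub_cancel_right _ _ (mainLaplace s)]
    refine (norm_sub_le _ _).trans ?_
    linarith
  have h := norm_coeff_le_of_norm_tsum_le hsum hB n
  simp only [ha] at h
  rw [Complex.norm_real, Real.norm_eq_abs, mul_assoc, ← Real.exp_add] at h
  refine h.trans ?_
  gcongr
  have hnn : (n : ℝ) = √n * √n := (Real.mul_self_sqrt (by linarith)).symm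
  have e1 : δ * n = Real.pi / 2 * √n := by
    rw [hδdef, div_mul_eq_mul_div, hnn]
    field_simp
    simp
  have e2 : 0.7175 / δ = 1.435 / Real.pi * √n := by
    rw [hδdef]; field_simp; norm_num
  rw [e1, e2, ← add_mul]
  gcongr
  have : 1.435 / Real.pi ≤ 0.457 := by
    rw [div_le_iff₀ hpi]; linarith [Real.pi_gt_d4]
  linarith [Real.pi_lt_d4]

/-- The exponentially dominant part of the main term, as a function of `y = π √t`. -/
noncomputable def mainTerm (t : ℝ) : ℝ :=
  Real.pi ^ 2 / 8 * (Real.exp (Real.pi * √t) * ((Real.pi * √t)⁻¹ ^ 2 - (Real.pi * √t)⁻¹ ^ 3))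

theorem mainTail_eq {t : ℝ} (ht : 0 < t) :
    mainTail t = 1 / (4 * t) * (Real.cosh (Real.pi * √t) -
      Real.sinh (Real.pi * √t) / (Real.pi * √t)) - Real.pi ^ 2 / 12 := by
  have hpi := Real.pi_pos
  set y := Real.pi * √t with hy
  have hy0 : 0 < y := mul_pos hpi (Real.sqrt_pos.mpr ht)
  have hy2 : y ^ 2 = Real.pi ^ 2 * t := by rw [hy, mul_pow, Real.sq_sqrt ht.le]
  have h := ((Real.hasSum_cosh y).sub ((Real.hasSum_sinh y).div_const y)).mul_left (1 / (4 * t))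
  rw [← hasSum_nat_add_iff' 2] at h
  rw [mainTail]
  refine HasSum.tsum_eq ?_
  convert! h using 1
  · funext i
    have e1 : y ^ (2 * (i + 2) + 1) / y = y ^ (2 * (i + 2)) := by
      rw [pow_succ]; field_simp
    rw [div_right_comm, e1, show 2 * (i + 2) + 1 = (2 * (i + 2)).succ by rfl, Nat.factorial_succ,
      pow_mul y, hy2, mainCoeff, show 2 * i + 5 = (2 * (i + 2)).succ by omega, Nat.factorial_succ,
      mul_pow, ← pow_mul]
    have := (2 * (i + 2)).factorial_pos
    push_cast
    field_simp
    ring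
  · simp only [Finset.sum_range_succ, Finset.sum_range_zero]
    norm_num [Nat.factorial]
    rw [hy2]
    field_simp
    rw [hy2]
    ring

theorem abs_overpartitionFn_sub_mainTerm_le {n : ℕ} (hn : 1000 ≤ n) :
    |(overpartitionFn n : ℝ) - mainTerm n| ≤ 3 * Real.exp (2.028 * √n) := by
  have hpi := Real.pi_pos
  have hnR : (1000 : ℝ) ≤ n := by exact_mod_cast hn
  have h := abs_overpartitionFn_sub_mainTail_le hn
  have hsn : (1 : ℝ) ≤ √n := by rw [Real.one_le_sqrt]; linarith
  have h1 : |mainTail n - mainTerm n| ≤ 1 := by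
    rw [mainTail_eq (by linarith), mainTerm]
    set y := Real.pi * √n with hy
    have hy1 : 1 ≤ y := by nlinarith [Real.pi_gt_three]
    have hy2 : (n : ℝ) = y ^ 2 / Real.pi ^ 2 := by
      rw [hy, mul_pow, Real.sq_sqrt (by linarith)]; field_simp
    have e : 1 / (4 * n) * (Real.cosh y - Real.sinh y / y) - Real.pi ^ 2 / 12 -
        Real.pi ^ 2 / 8 * (Real.exp y * (y⁻¹ ^ 2 - y⁻¹ ^ 3)) =
        1 / (8 * n) * Real.exp (-y) * (1 + 1 / y) - Real.pi ^ 2 / 12 := by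
      rw [hy2, Real.cosh_eq, Real.sinh_eq]
      field_simp
      ring
    rw [e]
    have h2 : Real.exp (-y) ≤ 1 := Real.exp_le_one_iff.mpr (by linarith)
    have h3 : 1 / y ≤ 1 := by rw [div_le_one (by linarith)]; exact hy1
    have h4 : 1 / (8 * (n : ℝ)) ≤ 1 / 4 := by
      apply one_div_le_one_div_of_le <;> linarith
    have h5 : 1 / (8 * n) * Real.exp (-y) * (1 + 1 / y) ≤ 1 / 4 * 1 * (1 + 1) := by gcongr
    have h6 : 0 ≤ 1 / (8 * n) * Real.exp (-y) * (1 + 1 / y) := by positivity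
    rw [abs_le]
    constructor <;> nlinarith [pi_sq_lt, sq_nonneg Real.pi]
  have h7 : 1 ≤ Real.exp (2.028 * √n) := Real.one_le_exp (by positivity)
  have := abs_sub_le (overpartitionFn n : ℝ) (mainTail n) (mainTerm n)
  linarith

/-- The function `e ^ y * y⁻ᵃ` of `t`, where `y = π √t`. -/
noncomputable def expPow (a : ℕ) (t : ℝ) : ℝ := Real.exp (Real.pi * √t) * (Real.pi * √t)⁻¹ ^ a

theorem hasDerivAt_expPow (a : ℕ) {t : ℝ} (ht : 0 < t) :
    HasDerivAt (expPow a)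
      (Real.pi ^ 2 / 2 * (expPow (a + 1) t - a * expPow (a + 2) t)) t := by
  have hpi := Real.pi_pos
  have hst : 0 < √t := Real.sqrt_pos.mpr ht
  have h1 : HasDerivAt (fun t ↦ Real.pi * √t) (Real.pi ^ 2 / 2 * (Real.pi * √t)⁻¹) t := by
    refine ((Real.hasDerivAt_sqrt ht.ne').const_mul _).congr_deriv ?_
    field_simp
  have h2 := h1.exp.mul ((h1.inv (by positivity)).pow a)
  refine h2.congr_deriv ?_
  simp only [expPow, Pi.inv_apply, Pi.pow_apply, div_eq_mul_inv, ← inv_pow]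
  generalize (Real.pi * √t)⁻¹ = w
  rcases a with _ | a
  · simp
    ring
  · simp only [Nat.add_sub_cancel]
    push_cast
    ring

/-- The main term up to a constant factor, as a combination of the functions `expPow`. -/
noncomputable def mainDeriv₀ (t : ℝ) : ℝ := expPow 2 t - expPow 3 t

/-- The first derivative of `mainDeriv₀`, up to a constant factor. -/
noncomputable def mainDeriv₁ (t : ℝ) : ℝ := expPow 3 t - 3 * expPow 4 t + 3 * expPow 5 t

/-- The second derivative of `mainDeriv₀`, up to a constant factor. -/
noncomputable def mainDeriv₂ (t : ℝ) : ℝ :=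
  expPow 4 t - 6 * expPow 5 t + 15 * expPow 6 t - 15 * expPow 7 t

/-- The third derivative of `mainDeriv₀`, up to a constant factor. -/
noncomputable def mainDeriv₃ (t : ℝ) : ℝ :=
  expPow 5 t - 10 * expPow 6 t + 45 * expPow 7 t - 105 * expPow 8 t + 105 * expPow 9 t

theorem hasDerivAt_mainDeriv₀ {t : ℝ} (ht : 0 < t) :
    HasDerivAt mainDeriv₀ (Real.pi ^ 2 / 2 * mainDeriv₁ t) t := by
  refine ((hasDerivAt_expPow 2 ht).sub (hasDerivAt_expPow 3 ht)).congr_deriv ?_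
  rw [mainDeriv₁]; push_cast; ring

theorem hasDerivAt_mainDeriv₁ {t : ℝ} (ht : 0 < t) :
    HasDerivAt mainDeriv₁ (Real.pi ^ 2 / 2 * mainDeriv₂ t) t := by
  refine (((hasDerivAt_expPow 3 ht).sub ((hasDerivAt_expPow 4 ht).const_mul 3)).add
    ((hasDerivAt_expPow 5 ht).const_mul 3)).congr_deriv ?_
  rw [mainDeriv₂]; push_cast; ring

theorem hasDerivAt_mainDeriv₂ {t : ℝ} (ht : 0 < t) :
    HasDerivAt mainDeriv₂ (Real.pi ^ 2 / 2 * mainDeriv₃ t) t := by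
  refine ((((hasDerivAt_expPow 4 ht).sub ((hasDerivAt_expPow 5 ht).const_mul 6)).add
    ((hasDerivAt_expPow 6 ht).const_mul 15)).sub
    ((hasDerivAt_expPow 7 ht).const_mul 15)).congr_deriv ?_
  rw [mainDeriv₃]; push_cast; ring

/-- The reciprocal `1 / (π √t)`, the natural small parameter. -/
noncomputable def recip (t : ℝ) : ℝ := (Real.pi * √t)⁻¹

theorem recip_pos {t : ℝ} (ht : 0 < t) : 0 < recip t :=
  inv_pos.mpr (mul_pos Real.pi_pos (Real.sqrt_pos.mpr ht))

theorem recip_le_of_le {t u : ℝ} (ht : 0 < t) (h : t ≤ u) : recip u ≤ recip t := by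
  have := Real.pi_pos
  have := Real.sqrt_pos.mpr ht
  rw [recip, recip]
  gcongr

theorem recip_le {t : ℝ} (ht : 1000 ≤ t) : recip t ≤ 0.0101 := by
  have h1 : (31.6 : ℝ) ≤ √t := by rw [Real.le_sqrt' (by norm_num)]; linarith
  rw [recip, inv_le_comm₀ (by have := Real.pi_pos; positivity) (by norm_num)]
  nlinarith [Real.pi_gt_d4]

theorem recip_sub_le {t u : ℝ} (ht : 0 < t) (hu : 0 < u) (htu : u ≤ t + 1) :
    recip t - 5 * recip t ^ 3 ≤ recip u := by
  have hpi := Real.pi_pos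
  refine le_trans ?_ (recip_le_of_le hu htu)
  have h1 := recip_pos ht
  have h2 := recip_pos (t := t + 1) (by linarith)
  have hle := recip_le_of_le ht (u := t + 1) (by linarith)
  have e (x : ℝ) (hx : 0 < x) : x * Real.pi ^ 2 * recip x ^ 2 = 1 := by
    rw [recip, inv_pow, mul_pow, Real.sq_sqrt hx.le]
    field_simp
  have e1 := e t ht
  have e2 := e (t + 1) (by linarith)
  set v := recip t
  set w := recip (t + 1)
  have e3 : (v - w) * (v + w) = Real.pi ^ 2 * v ^ 2 * w ^ 2 := by
    linear_combination w ^ 2 * e1 - v ^ 2 * e2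
  have e4 : Real.pi ^ 2 * v ^ 2 * w ^ 2 ≤ 5 * v ^ 3 * (v + w) := by
    have h10 : Real.pi ^ 2 ≤ 10 := by linarith [pi_sq_lt]
    have hw2 : w ^ 2 ≤ v * w := by nlinarith
    have hw3 : w * v ≤ v * v := by nlinarith
    calc _ ≤ 10 * v ^ 2 * w ^ 2 := by gcongr
      _ ≤ _ := by nlinarith [mul_nonneg (sq_nonneg v) (sub_nonneg.mpr hw2),
        mul_nonneg (sq_nonneg v) (sub_nonneg.mpr hw3)]
  have : v - w ≤ 5 * v ^ 3 := by
    refine le_of_mul_le_mul_right ?_ (by positivity : 0 < v + w)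
    linarith
  linarith

theorem mainDeriv_bounds {t : ℝ} (ht : 1000 ≤ t) :
    0.96 * (Real.exp (Real.pi * √t) * recip t ^ 3) ≤ mainDeriv₁ t ∧ 0 < mainDeriv₁ t ∧
    0 < mainDeriv₂ t ∧
    recip t * (1 - 3 * recip t) * mainDeriv₁ t ≤ mainDeriv₂ t ∧
    mainDeriv₂ t ≤ recip t * mainDeriv₁ t ∧
    mainDeriv₃ t ≤ recip t * (1 - 3.9 * recip t) * mainDeriv₂ t := by
  have hv := recip_pos (t := t) (by linarith)
  have hv1 := recip_le ht
  have hE := Real.exp_pos (Real.pi * √t)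
  simp only [mainDeriv₁, mainDeriv₂, mainDeriv₃, expPow]
  change _ ∧ _ ∧ _ ∧ _ ∧ _ ∧ _
  rw [← recip]
  set v := recip t
  set E := Real.exp (Real.pi * √t)
  have p1 : 0.96 ≤ 1 - 3 * v + 3 * v ^ 2 := by nlinarith
  have p2 : 0.9 ≤ 1 - 6 * v + 15 * v ^ 2 - 15 * v ^ 3 := by
    nlinarith [mul_nonneg (sq_nonneg v) (by linarith : 0 ≤ 1 - v)]
  have e1 : E * v ^ 3 - 3 * (E * v ^ 4) + 3 * (E * v ^ 5) =
      E * v ^ 3 * (1 - 3 * v + 3 * v ^ 2) := by ring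
  have e2 : E * v ^ 4 - 6 * (E * v ^ 5) + 15 * (E * v ^ 6) - 15 * (E * v ^ 7) =
      E * v ^ 4 * (1 - 6 * v + 15 * v ^ 2 - 15 * v ^ 3) := by ring
  have e3 : E * v ^ 5 - 10 * (E * v ^ 6) + 45 * (E * v ^ 7) - 105 * (E * v ^ 8) +
      105 * (E * v ^ 9) =
      E * v ^ 5 * (1 - 10 * v + 45 * v ^ 2 - 105 * v ^ 3 + 105 * v ^ 4) := by ring
  rw [e1, e2, e3]
  have q3 : 0 < E * v ^ 3 := by positivity
  have q4 : 0 < E * v ^ 4 := by positivity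
  have q5 : 0 < E * v ^ 5 := by positivity
  refine ⟨by nlinarith, by positivity, by positivity, ?_, ?_, ?_⟩
  · have : E * v ^ 4 * ((1 - 3 * v) * (1 - 3 * v + 3 * v ^ 2)) ≤
        E * v ^ 4 * (1 - 6 * v + 15 * v ^ 2 - 15 * v ^ 3) := by
      gcongr
      nlinarith [mul_nonneg (sq_nonneg v) (by linarith : 0 ≤ 1 - 2 * v)]
    linarith
  · have : E * v ^ 4 * (1 - 6 * v + 15 * v ^ 2 - 15 * v ^ 3) ≤
        E * v ^ 4 * (1 - 3 * v + 3 * v ^ 2) := by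
      gcongr
      nlinarith [pow_pos hv 3]
    linarith
  · have : E * v ^ 5 * (1 - 10 * v + 45 * v ^ 2 - 105 * v ^ 3 + 105 * v ^ 4) ≤
        E * v ^ 5 * ((1 - 3.9 * v) * (1 - 6 * v + 15 * v ^ 2 - 15 * v ^ 3)) := by
      gcongr
      have : 0 ≤ v * (0.1 - 6.6 * v + 31.5 * v ^ 2 - 46.5 * v ^ 3) := by
        have : 0 ≤ 0.1 - 6.6 * v - 46.5 * v ^ 3 := by
          have : v ^ 3 ≤ 0.0101 ^ 3 := by gcongr
          norm_num at this ⊢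
          nlinarith
        have : 0 ≤ 0.1 - 6.6 * v + 31.5 * v ^ 2 - 46.5 * v ^ 3 := by nlinarith [sq_nonneg v]
        positivity
      linarith
    linarith

end Overpartition

namespace Overpartition

open Set

/-- The forward difference of `mainDeriv₀`. -/
noncomputable def diff₀ (t : ℝ) : ℝ := mainDeriv₀ (t + 1) - mainDeriv₀ t

/-- The forward difference of `mainDeriv₁`. -/
noncomputable def diff₁ (t : ℝ) : ℝ := mainDeriv₁ (t + 1) - mainDeriv₁ t

/-- The forward difference of `mainDeriv₂`. -/
noncomputable def diff₂ (t : ℝ) : ℝ := mainDeriv₂ (t + 1) - mainDeriv₂ t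

theorem hasDerivAt_diff₀ {t : ℝ} (ht : 0 < t) :
    HasDerivAt diff₀ (Real.pi ^ 2 / 2 * diff₁ t) t := by
  refine (((hasDerivAt_mainDeriv₀ (t := t + 1) (by linarith)).comp_add_const t 1).sub
    (hasDerivAt_mainDeriv₀ ht)).congr_deriv ?_
  rw [diff₁]; ring

theorem hasDerivAt_diff₁ {t : ℝ} (ht : 0 < t) :
    HasDerivAt diff₁ (Real.pi ^ 2 / 2 * diff₂ t) t := by
  refine (((hasDerivAt_mainDeriv₁ (t := t + 1) (by linarith)).comp_add_const t 1).sub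
    (hasDerivAt_mainDeriv₁ ht)).congr_deriv ?_
  rw [diff₂]; ring

theorem exists_sub_eq_of_hasDerivAt {f f' : ℝ → ℝ} {t : ℝ}
    (hf : ∀ x, t ≤ x → HasDerivAt f (f' x) x) :
    ∃ c ∈ Ioo t (t + 1), f (t + 1) - f t = f' c := by
  obtain ⟨c, hc, h⟩ := exists_hasDerivAt_eq_slope f f' (lt_add_one t)
    (fun x hx ↦ (hf x hx.1).continuousAt.continuousWithinAt) (fun x hx ↦ hf x hx.1.le)
  refine ⟨c, hc, ?_⟩
  rw [h]; simp

theorem exists_sub_mul_eq_of_hasDerivAt {f f' g g' : ℝ → ℝ} {t : ℝ}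
    (hf : ∀ x, t ≤ x → HasDerivAt f (f' x) x) (hg : ∀ x, t ≤ x → HasDerivAt g (g' x) x) :
    ∃ c ∈ Ioo t (t + 1), (g (t + 1) - g t) * f' c = (f (t + 1) - f t) * g' c :=
  exists_ratio_hasDerivAt_eq_ratio_slope f f' (lt_add_one t)
    (fun x hx ↦ (hf x hx.1).continuousAt.continuousWithinAt) (fun x hx ↦ hf x hx.1.le) g g'
    (fun x hx ↦ (hg x hx.1).continuousAt.continuousWithinAt) (fun x hx ↦ hg x hx.1.le)

theorem exists_diff₀_eq {t : ℝ} (ht : 1000 ≤ t) :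
    ∃ c ∈ Ioo t (t + 1), diff₀ t = Real.pi ^ 2 / 2 * mainDeriv₁ c :=
  exists_sub_eq_of_hasDerivAt fun _ hx ↦ hasDerivAt_mainDeriv₀ (by linarith)

theorem diff₀_pos {t : ℝ} (ht : 1000 ≤ t) : 0 < diff₀ t := by
  obtain ⟨c, hc, h⟩ := exists_diff₀_eq ht
  have := (mainDeriv_bounds (t := c) (by linarith [hc.1])).2.1
  have := Real.pi_pos
  rw [h]; positivity

theorem diff₁_pos {t : ℝ} (ht : 1000 ≤ t) : 0 < diff₁ t := by
  obtain ⟨c, hc, h⟩ : ∃ c ∈ Ioo t (t + 1), diff₁ t = Real.pi ^ 2 / 2 * mainDeriv₂ c :=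
    exists_sub_eq_of_hasDerivAt fun _ hx ↦ hasDerivAt_mainDeriv₁ (by linarith)
  have := (mainDeriv_bounds (t := c) (by linarith [hc.1])).2.2.1
  have := Real.pi_pos
  rw [h]; positivity

theorem diff_ratio_bounds {t : ℝ} (ht : 1000 ≤ t) :
    recip t * (1 - 3.06 * recip t) * diff₀ t ≤ diff₁ t ∧ diff₁ t ≤ recip t * diff₀ t ∧
      diff₂ t ≤ recip t * (1 - 3.9 * recip t) * diff₁ t := by
  have hpi := Real.pi_pos
  have hV := recip_pos (t := t) (by linarith)
  have hV1 := recip_le ht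
  have hd0 := diff₀_pos ht
  have hd1 := diff₁_pos ht
  obtain ⟨x, hx, ex⟩ : ∃ c ∈ Ioo t (t + 1), diff₁ t * (Real.pi ^ 2 / 2 * mainDeriv₁ c) =
      diff₀ t * (Real.pi ^ 2 / 2 * mainDeriv₂ c) :=
    exists_sub_mul_eq_of_hasDerivAt (fun _ hx ↦ hasDerivAt_mainDeriv₀ (by linarith))
      fun _ hx ↦ hasDerivAt_mainDeriv₁ (by linarith)
  obtain ⟨y, hy, ey⟩ : ∃ c ∈ Ioo t (t + 1), diff₂ t * (Real.pi ^ 2 / 2 * mainDeriv₂ c) =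
      diff₁ t * (Real.pi ^ 2 / 2 * mainDeriv₃ c) :=
    exists_sub_mul_eq_of_hasDerivAt (fun _ hx ↦ hasDerivAt_mainDeriv₁ (by linarith))
      fun _ hx ↦ hasDerivAt_mainDeriv₂ (by linarith)
  have hx' : diff₁ t * mainDeriv₁ x = diff₀ t * mainDeriv₂ x := by
    have : Real.pi ^ 2 / 2 ≠ 0 := by positivity
    apply mul_left_cancel₀ this
    linarith
  have hy' : diff₂ t * mainDeriv₂ y = diff₁ t * mainDeriv₃ y := by
    have : Real.pi ^ 2 / 2 ≠ 0 := by positivity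
    apply mul_left_cancel₀ this
    linarith
  obtain ⟨-, b1, b2, b3, b4, -⟩ := mainDeriv_bounds (t := x) (by linarith [hx.1])
  obtain ⟨-, -, c2, -, -, c5⟩ := mainDeriv_bounds (t := y) (by linarith [hy.1])
  have hvx := recip_le_of_le (by linarith) hx.1.le
  have hvy := recip_le_of_le (by linarith) hy.1.le
  have hvy0 := recip_pos (t := y) (by linarith [hy.1])
  have hvx0 := recip_pos (t := x) (by linarith [hx.1])
  have hvx' := recip_sub_le (t := t) (u := x) (by linarith) (by linarith [hx.1]) hx.2.le
  set V := recip t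
  set v := recip x
  set w := recip y
  refine ⟨?_, ?_, ?_⟩
  · refine le_of_mul_le_mul_right ?_ b1
    have h1 : V * (1 - 3.06 * V) ≤ v * (1 - 3 * v) := by
      have h2 : V ^ 3 ≤ 0.0101 * V ^ 2 := by nlinarith [sq_nonneg V]
      nlinarith
    calc _ = diff₀ t * (V * (1 - 3.06 * V) * mainDeriv₁ x) := by ring
      _ ≤ diff₀ t * (v * (1 - 3 * v) * mainDeriv₁ x) := by gcongr
      _ ≤ diff₀ t * mainDeriv₂ x := by gcongr
      _ = _ := hx'.symm
  · refine le_of_mul_le_mul_right ?_ b1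
    calc _ = diff₀ t * mainDeriv₂ x := hx'
      _ ≤ diff₀ t * (v * mainDeriv₁ x) := by gcongr
      _ ≤ diff₀ t * (V * mainDeriv₁ x) := by gcongr
      _ = _ := by ring
  · refine le_of_mul_le_mul_right ?_ c2
    have h1 : w * (1 - 3.9 * w) ≤ V * (1 - 3.9 * V) := by nlinarith
    calc _ = diff₁ t * mainDeriv₃ y := hy'
      _ ≤ diff₁ t * (w * (1 - 3.9 * w) * mainDeriv₂ y) := by gcongr
      _ ≤ diff₁ t * (V * (1 - 3.9 * V) * mainDeriv₂ y) := by gcongr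
      _ = _ := by ring

theorem hasDerivAt_log_diff₀ {t : ℝ} (ht : 1000 ≤ t) :
    HasDerivAt (fun t ↦ Real.log (diff₀ t)) (Real.pi ^ 2 / 2 * (diff₁ t / diff₀ t)) t := by
  refine ((hasDerivAt_diff₀ (by linarith)).log (diff₀_pos ht).ne').congr_deriv ?_
  ring

theorem hasDerivAt_diff_ratio {t : ℝ} (ht : 1000 ≤ t) :
    HasDerivAt (fun t ↦ diff₁ t / diff₀ t)
      (Real.pi ^ 2 / 2 * ((diff₂ t * diff₀ t - diff₁ t ^ 2) / diff₀ t ^ 2)) t := by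
  refine ((hasDerivAt_diff₁ (by linarith)).div (hasDerivAt_diff₀ (by linarith))
    (diff₀_pos ht).ne').congr_deriv ?_
  ring

theorem diff_ratio_deriv_le {t : ℝ} (ht : 1000 ≤ t) :
    (diff₂ t * diff₀ t - diff₁ t ^ 2) / diff₀ t ^ 2 ≤ -(0.8 * recip t ^ 3) := by
  have hd0 := diff₀_pos ht
  have hd1 := diff₁_pos ht
  have hV := recip_pos (t := t) (by linarith)
  have hV1 := recip_le ht
  obtain ⟨h1, -, h3⟩ := diff_ratio_bounds ht
  set V := recip t
  rw [div_le_iff₀ (by positivity)]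
  have h4 : diff₂ t * diff₀ t ≤ V * (1 - 3.9 * V) * diff₁ t * diff₀ t := by gcongr
  have h5 : V * (1 - 3.06 * V) * diff₀ t * diff₁ t ≤ diff₁ t * diff₁ t := by gcongr
  have h6 : 0.96 * V * diff₀ t ≤ diff₁ t := by
    refine le_trans ?_ h1
    gcongr ?_ * _
    nlinarith
  have h7 : 0.84 * V ^ 2 * diff₀ t * (0.96 * V * diff₀ t) ≤
      0.84 * V ^ 2 * diff₀ t * diff₁ t := by gcongr
  have h8 : 0 < V ^ 3 * diff₀ t ^ 2 := by positivity
  nlinarith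

theorem log_diff₀_add_two_le {t : ℝ} (ht : 1000 ≤ t) :
    Real.log (diff₀ (t + 2)) - 2 * Real.log (diff₀ (t + 1)) + Real.log (diff₀ t) ≤
      -(Real.pi ^ 4 / 4 * (0.8 * recip (t + 2) ^ 3)) := by
  obtain ⟨u, hu, h1⟩ : ∃ c ∈ Ioo t (t + 1), _ = _ :=
    exists_sub_eq_of_hasDerivAt fun x (hx : t ≤ x) ↦
      ((hasDerivAt_log_diff₀ (t := x + 1) (by linarith)).comp_add_const x 1).sub
        (hasDerivAt_log_diff₀ (t := x) (by linarith))
  obtain ⟨c, hc, h2⟩ : ∃ c ∈ Ioo u (u + 1), _ = _ :=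
    exists_sub_eq_of_hasDerivAt fun x (hx : u ≤ x) ↦
      hasDerivAt_diff_ratio (t := x) (by linarith [hu.1])
  have h3 := diff_ratio_deriv_le (t := c) (by linarith [hu.1, hc.1])
  have h4 : recip (t + 2) ^ 3 ≤ recip c ^ 3 := by
    have := recip_pos (t := t + 2) (by linarith)
    have := recip_le_of_le (t := c) (u := t + 2) (by linarith [hu.1, hc.1])
      (by linarith [hu.2, hc.2])
    gcongr
  have e : t + 1 + 1 = t + 2 := by ring
  simp only [Pi.sub_apply, e] at h1 h2
  calc _ = Real.pi ^ 2 / 2 * (diff₁ (u + 1) / diff₀ (u + 1) - diff₁ u / diff₀ u) := by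
        linarith
    _ = Real.pi ^ 4 / 4 * ((diff₂ c * diff₀ c - diff₁ c ^ 2) / diff₀ c ^ 2) := by
        rw [h2]; ring
    _ ≤ Real.pi ^ 4 / 4 * (-(0.8 * recip (t + 2) ^ 3)) := by gcongr; linarith
    _ = _ := by ring

theorem diff₀_mul_diff₀_le {t : ℝ} (ht : 1000 ≤ t) :
    diff₀ t * diff₀ (t + 2) ≤
      Real.exp (-(Real.pi ^ 4 / 4 * (0.8 * recip (t + 2) ^ 3))) * diff₀ (t + 1) ^ 2 := by
  have h0 := diff₀_pos ht
  have h1 := diff₀_pos (t := t + 1) (by linarith)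
  have h2 := diff₀_pos (t := t + 2) (by linarith)
  rw [← Real.log_le_log_iff (by positivity) (by positivity), Real.log_mul h0.ne' h2.ne',
    Real.log_mul (Real.exp_pos _).ne' (by positivity), Real.log_exp, Real.log_pow]
  push_cast
  linarith [log_diff₀_add_two_le ht]

theorem diff₀_le {t : ℝ} (ht : 1000 ≤ t) : diff₀ t ≤ diff₀ (t + 1) := by
  obtain ⟨c, hc, h⟩ : ∃ c ∈ Ioo t (t + 1), _ = _ :=
    exists_sub_eq_of_hasDerivAt fun x (hx : t ≤ x) ↦ hasDerivAt_diff₀ (t := x) (by linarith)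
  have := diff₁_pos (t := c) (by linarith [hc.1])
  have : 0 < Real.pi ^ 2 / 2 * diff₁ c := by have := Real.pi_pos; positivity
  linarith

theorem diff₀_add_one_le {t : ℝ} (ht : 1000 ≤ t) : diff₀ (t + 1) ≤ 2 * diff₀ t := by
  obtain ⟨c, hc, h⟩ : ∃ c ∈ Ioo t (t + 1), _ = _ :=
    exists_sub_eq_of_hasDerivAt fun x (hx : t ≤ x) ↦ hasDerivAt_log_diff₀ (t := x) (by linarith)
  have hct : 1000 ≤ c := by linarith [hc.1]
  have h1 : diff₁ c / diff₀ c ≤ 0.0101 := by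
    refine le_trans ?_ (recip_le hct)
    rw [div_le_iff₀ (diff₀_pos hct)]
    exact (diff_ratio_bounds hct).2.1
  have h2 : Real.pi ^ 2 / 2 * (diff₁ c / diff₀ c) ≤ Real.log 2 := by
    have : Real.pi ^ 2 / 2 * (diff₁ c / diff₀ c) ≤ Real.pi ^ 2 / 2 * 0.0101 := by gcongr
    linarith [pi_sq_lt, Real.log_two_gt_d9]
  have h0 := diff₀_pos ht
  rw [← Real.log_le_log_iff (diff₀_pos (by linarith)) (by positivity),
    Real.log_mul (by norm_num) h0.ne']
  linarith

theorem pow_six_lt_exp {x : ℝ} (hx : 31.6 ≤ x) : 729 * x ^ 6 ≤ Real.exp (1.11 * x) := by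
  have h5 : (143 : ℝ) ≤ Real.exp 5 := by
    have : Real.exp 5 = Real.exp 1 ^ 5 := by rw [← Real.exp_nat_mul]; norm_num
    rw [this]
    calc (143 : ℝ) ≤ 2.7 ^ 5 := by norm_num
      _ ≤ _ := by
        gcongr
        linarith [Real.exp_one_gt_d9]
  have h1 : 3 * x ≤ Real.exp (0.185 * x) := by
    have h2 := Real.add_one_le_exp (0.185 * x - 5)
    calc 3 * x ≤ 143 * (0.185 * x - 5 + 1) := by linarith
      _ ≤ Real.exp 5 * Real.exp (0.185 * x - 5) := by
        gcongr
        linarith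
      _ = _ := by rw [← Real.exp_add]; ring_nf
  calc 729 * x ^ 6 = (3 * x) ^ 6 := by ring
    _ ≤ Real.exp (0.185 * x) ^ 6 := by gcongr
    _ = _ := by rw [← Real.exp_nat_mul]; ring_nf

/-- The difference of the main term beats the error term by the margin needed below. -/
theorem error_lt_diff₀ {t : ℝ} (ht : 1000 ≤ t) :
    12 * (6 * Real.exp (2.028 * √(t + 3))) * √(t + 2) ^ 3 <
      Real.pi ^ 2 / 8 * diff₀ (t + 1) * 0.6 := by
  have hpi := Real.pi_pos
  obtain ⟨c, hc, h⟩ := exists_diff₀_eq (t := t + 1) (by linarith)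
  have hb := (mainDeriv_bounds (t := c) (by linarith [hc.1])).1
  set x := √(t + 1) with hxdef
  have hx2 : x ^ 2 = t + 1 := Real.sq_sqrt (by linarith)
  have hx : 31.6 ≤ x := by rw [hxdef, Real.le_sqrt' (by norm_num)]; linarith
  have hz2 : √(t + 2) ^ 2 = t + 2 := Real.sq_sqrt (by linarith)
  set z := √(t + 2)
  have hz : 0 < z := Real.sqrt_pos.mpr (by linarith)
  have hc2 : c ≤ t + 2 := by linarith [hc.2]
  have hr := recip_le_of_le (by linarith [hc.1]) hc2
  have hr0 := recip_pos (t := t + 2) (by linarith)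
  have hcx : x ≤ √c := Real.sqrt_le_sqrt hc.1.le
  have h1 : 0.96 * (Real.exp (Real.pi * x) * (Real.pi * z)⁻¹ ^ 3) ≤ mainDeriv₁ c := by
    refine le_trans ?_ hb
    rw [recip] at hr hr0
    gcongr
  have h2 : √(t + 3) ≤ x + 0.032 := by
    rw [Real.sqrt_le_left (by linarith)]
    nlinarith
  have h3 : Real.exp (2.028 * √(t + 3)) ≤ 1.1 * Real.exp (2.028 * x) := by
    have h4 : Real.exp 0.065 ≤ 1.1 := by
      have := Real.exp_bound_div_one_sub_of_interval (x := 0.065) (by norm_num) (by norm_num)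
      refine this.trans ?_
      norm_num
    calc _ ≤ Real.exp (0.065 + 2.028 * x) := by gcongr; linarith
      _ = Real.exp 0.065 * Real.exp (2.028 * x) := Real.exp_add _ _
      _ ≤ _ := by gcongr
  have h5 : z ^ 6 ≤ 1.004 * x ^ 6 := by
    calc z ^ 6 = (z ^ 2) ^ 3 := by ring
      _ ≤ (1.001 * x ^ 2) ^ 3 := by
        gcongr
        linarith
      _ ≤ _ := by
        have : 0 ≤ x ^ 6 := by positivity
        linarith
  have h6 : 729 * x ^ 6 * Real.exp (2.028 * x) ≤ Real.exp (Real.pi * x) := by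
    calc _ ≤ Real.exp (1.11 * x) * Real.exp (2.028 * x) := by
          gcongr
          exact pow_six_lt_exp hx
      _ = Real.exp (3.138 * x) := by rw [← Real.exp_add]; ring_nf
      _ ≤ _ := by
        gcongr
        linarith [Real.pi_gt_d4]
  have h7 : 0.036 * Real.pi * Real.exp (Real.pi * x) / z ^ 3 ≤
      Real.pi ^ 2 / 8 * diff₀ (t + 1) * 0.6 := by
    rw [h]
    calc _ = Real.pi ^ 2 / 8 * (Real.pi ^ 2 / 2 *
          (0.96 * (Real.exp (Real.pi * x) * (Real.pi * z)⁻¹ ^ 3))) * 0.6 := by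
          field_simp
          norm_num
      _ ≤ _ := by gcongr
  refine lt_of_lt_of_le ?_ h7
  rw [lt_div_iff₀ (by positivity)]
  have hX : 0 < x ^ 6 * Real.exp (2.028 * x) := by positivity
  calc _ = 72 * Real.exp (2.028 * √(t + 3)) * z ^ 6 := by ring
    _ ≤ 72 * (1.1 * Real.exp (2.028 * x)) * (1.004 * x ^ 6) := by gcongr
    _ < 0.113 * (729 * x ^ 6 * Real.exp (2.028 * x)) := by linarith
    _ ≤ 0.113 * Real.exp (Real.pi * x) := by gcongr
    _ ≤ _ := by
      gcongr
      linarith [Real.pi_gt_d4]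

theorem mul_lt_sq_of_abs_sub_le {a₀ a₁ a₂ b₀ b₁ b₂ ε δ : ℝ} (hb₀ : 0 < b₀) (hb₁ : 0 < b₁)
    (hb₂ : 0 < b₂) (h₀ : |a₀ - b₀| ≤ ε) (h₁ : |a₁ - b₁| ≤ ε) (h₂ : |a₂ - b₂| ≤ ε)
    (h01 : b₀ ≤ b₁) (h12 : b₂ ≤ 2 * b₁) (hδ : 0 < δ) (hδ1 : δ ≤ 1)
    (hb : b₀ * b₂ ≤ Real.exp (-δ) * b₁ ^ 2) (hε : 12 * ε < b₁ * δ) : a₀ * a₂ < a₁ ^ 2 := by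
  have hε0 : 0 ≤ ε := (abs_nonneg _).trans h₀
  have hexp : Real.exp (-δ) ≤ 1 - δ / 2 := by
    rw [Real.exp_neg, inv_le_comm₀ (Real.exp_pos _) (by linarith)]
    refine le_trans ?_ (Real.add_one_le_exp δ)
    rw [inv_le_comm₀ (by linarith) (by linarith), inv_le_iff_one_le_mul₀ (by linarith)]
    nlinarith
  have hεb : ε ≤ b₁ := by nlinarith
  have k1 : a₀ * a₂ ≤ (b₀ + ε) * (b₂ + ε) := by
    have e0 : |a₀| ≤ b₀ + ε := by
      rw [abs_le] at h₀ ⊢; constructor <;> linarith [h₀.1, h₀.2]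
    have e2 : |a₂| ≤ b₂ + ε := by
      rw [abs_le] at h₂ ⊢; constructor <;> linarith [h₂.1, h₂.2]
    calc _ ≤ |a₀ * a₂| := le_abs_self _
      _ = |a₀| * |a₂| := abs_mul _ _
      _ ≤ _ := by gcongr
  have k2 : b₁ ^ 2 - 2 * ε * b₁ ≤ a₁ ^ 2 := by
    have := (abs_le.mp h₁).1
    nlinarith [sq_nonneg (a₁ - b₁)]
  have k3 : b₀ * b₂ ≤ (1 - δ / 2) * b₁ ^ 2 := hb.trans (by gcongr)
  have k4 : 12 * ε * b₁ < b₁ * δ * b₁ := by gcongr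
  have k5 : ε * b₀ ≤ ε * b₁ := by gcongr
  have k6 : ε * b₂ ≤ ε * (2 * b₁) := by gcongr
  have k7 : ε * ε ≤ ε * b₁ := by gcongr
  nlinarith

theorem abs_sub_diff₀_le {m : ℕ} (hm : 1000 ≤ m) {u : ℝ} (hu : (m : ℝ) + 1 ≤ u) :
    |((overpartitionFn (m + 1) : ℝ) - overpartitionFn m) - Real.pi ^ 2 / 8 * diff₀ m| ≤
      6 * Real.exp (2.028 * √u) := by
  have h0 := abs_overpartitionFn_sub_mainTerm_le hm
  have h1 := abs_overpartitionFn_sub_mainTerm_le (n := m + 1) (by omega)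
  have e (t : ℝ) : mainTerm t = Real.pi ^ 2 / 8 * mainDeriv₀ t := by
    simp only [mainTerm, mainDeriv₀, expPow]; ring
  rw [e] at h0 h1
  push_cast at h1
  have g0 : Real.exp (2.028 * √m) ≤ Real.exp (2.028 * √u) := by gcongr; linarith
  have g1 : Real.exp (2.028 * √(m + 1)) ≤ Real.exp (2.028 * √u) := by gcongr
  rw [diff₀]
  rw [abs_le] at *
  constructor <;> linarith [h0.1, h0.2, h1.1, h1.2]

theorem mul_lt_sq_of_large {m : ℕ} (hm : 1000 ≤ m) :
    ((overpartitionFn (m + 1) : ℝ) - overpartitionFn m) *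
      ((overpartitionFn (m + 3) : ℝ) - overpartitionFn (m + 2)) <
      ((overpartitionFn (m + 2) : ℝ) - overpartitionFn (m + 1)) ^ 2 := by
  have ht : (1000 : ℝ) ≤ m := by exact_mod_cast hm
  have hpi := Real.pi_pos
  have hz : 31.6 ≤ √((m : ℝ) + 2) := by rw [Real.le_sqrt' (by norm_num)]; linarith
  have d0 := diff₀_pos ht
  have d1 := diff₀_pos (t := (m : ℝ) + 1) (by linarith)
  have d2 := diff₀_pos (t := (m : ℝ) + 2) (by linarith)
  have h0 := abs_sub_diff₀_le hm (u := m + 3) (by linarith)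
  have h1 := abs_sub_diff₀_le (m := m + 1) (by omega) (u := m + 3) (by push_cast; linarith)
  have h2 := abs_sub_diff₀_le (m := m + 2) (by omega) (u := m + 3) (by push_cast; linarith)
  push_cast at h1 h2
  have hE := error_lt_diff₀ ht
  have l01 := diff₀_le ht
  have l12 := diff₀_add_one_le (t := (m : ℝ) + 1) (by linarith)
  rw [add_assoc, one_add_one_eq_two] at l12
  have hmul := diff₀_mul_diff₀_le ht
  rw [recip] at hmul
  set z := √((m : ℝ) + 2)
  have hz3 : (1 : ℝ) ≤ z ^ 3 := one_le_pow₀ (by linarith)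
  refine mul_lt_sq_of_abs_sub_le (δ := 0.6 / z ^ 3) (by positivity) (by positivity)
    (by positivity) h0 h1 h2 (by gcongr) (by nlinarith [sq_nonneg Real.pi]) (by positivity)
    ?_ ?_ ?_
  · rw [div_le_one₀ (by positivity)]; linarith
  · have h3 : Real.exp (-(Real.pi ^ 4 / 4 * (0.8 * (Real.pi * z)⁻¹ ^ 3))) ≤
        Real.exp (-(0.6 / z ^ 3)) := by
      gcongr
      calc 0.6 / z ^ 3 ≤ 0.2 * Real.pi / z ^ 3 := by
            gcongr
            linarith [Real.pi_gt_three]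
        _ = _ := by field_simp; norm_num
    calc _ = (Real.pi ^ 2 / 8) ^ 2 * (diff₀ m * diff₀ (m + 2)) := by ring
      _ ≤ (Real.pi ^ 2 / 8) ^ 2 * (Real.exp (-(0.6 / z ^ 3)) * diff₀ (m + 1) ^ 2) := by
        refine mul_le_mul_of_nonneg_left (hmul.trans ?_) (by positivity)
        exact mul_le_mul_of_nonneg_right h3 (by positivity)
      _ = _ := by ring
  · rw [← mul_div_assoc, lt_div_iff₀ (by positivity)]
    exact hE

end Overpartition

namespace Overpartition

/-- The coefficients of `theta`. -/
def thetaCoeff (k : ℕ) : ℤ := if k = 0 then 1 else if IsSquare k then 2 * (-1) ^ k else 0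

theorem hasSum_thetaCoeff {q : ℂ} (hq : ‖q‖ < 1) :
    HasSum (fun k ↦ (thetaCoeff k : ℂ) * q ^ k) (theta q) := by
  have hinj : Function.Injective fun j : ℕ ↦ j ^ 2 := fun a b h ↦ by simpa using h
  rw [← hinj.hasSum_iff]
  · rw [← hasSum_nat_add_iff' 1]
    have h := (Summable.of_norm (summable_theta hq)).hasSum.mul_left 2
    convert! h using 1
    · ext j
      have h1 : (-1 : ℂ) ^ (j + 1) ^ 2 = (-1) ^ (j + 1) := by
        rcases Nat.even_or_odd (j + 1) with h | h
        · rw [h.neg_one_pow, (h.pow_of_ne_zero two_ne_zero).neg_one_pow]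
        · rw [h.neg_one_pow, h.pow.neg_one_pow]
      have h2 : IsSquare ((j + 1) ^ 2) := ⟨j + 1, sq _⟩
      simp [thetaCoeff, h1, h2, mul_assoc]
    · simp [theta, thetaCoeff]
  · intro k hk
    have h0 : k ≠ 0 := by rintro rfl; exact hk ⟨0, rfl⟩
    have hs : ¬ IsSquare k := by
      rintro ⟨r, rfl⟩
      exact hk ⟨r, by simp [sq]⟩
    simp [thetaCoeff, h0, hs]

theorem eq_of_forall_hasSum_pow {a b : ℕ → ℂ} {f : ℂ → ℂ}
    (ha : ∀ q : ℂ, ‖q‖ < 1 → HasSum (fun n ↦ a n * q ^ n) (f q))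
    (hb : ∀ q : ℂ, ‖q‖ < 1 → HasSum (fun n ↦ b n * q ^ n) (f q)) : a = b := by
  have key (c : ℕ → ℂ) (hc : ∀ q : ℂ, ‖q‖ < 1 → HasSum (fun n ↦ c n * q ^ n) (f q)) :
      HasFPowerSeriesAt f (FormalMultilinearSeries.ofScalars ℂ c) 0 := by
    rw [hasFPowerSeriesAt_iff]
    filter_upwards [Metric.ball_mem_nhds (0 : ℂ) one_pos] with z hz
    simpa [mul_comm] using hc z (by simpa using hz)
  have h := (key a ha).eq_formalMultilinearSeries (key b hb)
  ext n
  simpa using congrArg (fun p ↦ FormalMultilinearSeries.coeff p n) h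

theorem sum_antidiagonal_overpartitionFn_mul_thetaCoeff (n : ℕ) :
    ∑ p ∈ Finset.HasAntidiagonal.antidiagonal n,
      (overpartitionFn p.1 : ℤ) * thetaCoeff p.2 = if n = 0 then 1 else 0 := by
  have h : (fun n ↦ ∑ p ∈ Finset.HasAntidiagonal.antidiagonal n,
      (overpartitionFn p.1 : ℂ) * thetaCoeff p.2) = fun n ↦ if n = 0 then (1 : ℂ) else 0 := by
    refine eq_of_forall_hasSum_pow (f := fun _ ↦ 1) (fun q hq ↦ ?_) fun q hq ↦ ?_
    · have h1 := summable_norm_overpartition hq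
      have h2 := (hasSum_thetaCoeff hq).summable.norm
      have h3 := (summable_norm_sum_mul_antidiagonal_of_summable_norm h1 h2).of_norm.hasSum
      rw [← tsum_mul_tsum_eq_tsum_sum_antidiagonal_of_summable_norm h1 h2,
        (hasSum_thetaCoeff hq).tsum_eq, ← genFun, genFun_mul_theta hq] at h3
      refine h3.congr_fun fun n ↦ ?_
      rw [Finset.sum_mul]
      refine Finset.sum_congr rfl fun p hp ↦ ?_
      rw [← Finset.HasAntidiagonal.mem_antidiagonal.mp hp, pow_add]
      ring
    · convert! hasSum_ite_eq 0 (1 : ℂ) using 2 with n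
      split_ifs with h <;> simp [h]
  have := congrFun h n
  exact_mod_cast this

/-- The recurrence for overpartitions, for arguments below `33 ^ 2`. -/
theorem overpartitionFn_recurrence {n : ℕ} (hn : 1 ≤ n) (hn' : n < 1089) :
    (overpartitionFn n : ℤ) = 2 * ∑ i ∈ Finset.range 32,
      (-1) ^ i * if (i + 1) ^ 2 ≤ n then (overpartitionFn (n - (i + 1) ^ 2) : ℤ) else 0 := by
  have h := sum_antidiagonal_overpartitionFn_mul_thetaCoeff n
  rw [if_neg (by omega), ← Finset.Nat.sum_antidiagonal_swap] at h
  simp only [Prod.fst_swap, Prod.snd_swap] at h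
  rw [Finset.Nat.sum_antidiagonal_eq_sum_range_succ
    fun i j ↦ (overpartitionFn j : ℤ) * thetaCoeff i] at h
  set g : ℕ → ℤ := fun k ↦ if k ≤ n then (overpartitionFn (n - k) : ℤ) * thetaCoeff k else 0
  have h1 : ∑ k ∈ Finset.range 1089, g k = 0 := by
    rw [← h]
    symm
    refine (Finset.sum_congr rfl fun k hk ↦ ?_).trans
      (Finset.sum_subset (f := g) (Finset.range_subset_range.mpr (by omega : n + 1 ≤ 1089))
        fun k _ hk ↦ ?_)
    · rw [Finset.mem_range] at hk
      simp only [g]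
      rw [if_pos (by omega)]
    · rw [Finset.mem_range] at hk
      simp only [g]
      rw [if_neg (by omega)]
  have h2 : ∑ s ∈ Finset.range 33, g (s ^ 2) = 0 := by
    rw [← h1, ← Finset.sum_image (s := Finset.range 33) (g := fun s ↦ s ^ 2) (f := g)
      (fun a _ b _ h ↦ by simpa using h)]
    refine Finset.sum_subset (fun k hk ↦ ?_) fun k hk hk' ↦ ?_
    · simp only [Finset.mem_image, Finset.mem_range] at hk ⊢
      obtain ⟨s, hs, rfl⟩ := hk
      nlinarith
    · have hs : ¬ IsSquare k := by
        rintro ⟨r, rfl⟩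
        rw [Finset.mem_range] at hk
        exact hk' (Finset.mem_image.mpr ⟨r, Finset.mem_range.mpr (by nlinarith), sq r⟩)
      have h0 : k ≠ 0 := by rintro rfl; exact hs ⟨0, rfl⟩
      simp [g, thetaCoeff, hs, h0]
  rw [Finset.sum_range_succ'] at h2
  have h3 : g (0 ^ 2) = overpartitionFn n := by simp [g, thetaCoeff]
  rw [h3] at h2
  rw [eq_neg_of_add_eq_zero_right h2, Finset.mul_sum, ← Finset.sum_neg_distrib]
  refine Finset.sum_congr rfl fun i _ ↦ ?_
  have e : (-1 : ℤ) ^ (i + 1) ^ 2 = (-1) ^ (i + 1) := by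
    rcases Nat.even_or_odd (i + 1) with h | h
    · rw [h.neg_one_pow, (h.pow_of_ne_zero two_ne_zero).neg_one_pow]
    · rw [h.neg_one_pow, h.pow.neg_one_pow]
  simp only [g, thetaCoeff]
  split_ifs with h5 h6 h7
  · simp at h6
  · rw [e]; ring
  · exact absurd ⟨i + 1, sq _⟩ h7
  · simp

/-- The `j`-th digit of `P` in base `2 ^ 136`. -/
def digit (P j : ℕ) : ℕ := P / (2 ^ 136) ^ j % 2 ^ 136

/-- The sum of the `k` digits of `P` at the positions `(2 i + r) ^ 2 - 1`. -/
def digitSum (P r : ℕ) : ℕ → ℕ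
  | 0 => 0
  | i + 1 => digitSum P r i + digit P ((2 * i + r) ^ 2 - 1)

theorem digitSum_eq (P r k : ℕ) :
    digitSum P r k = ∑ i ∈ Finset.range k, digit P ((2 * i + r) ^ 2 - 1) := by
  induction k with
  | zero => rfl
  | succ k ih => rw [digitSum, ih, Finset.sum_range_succ]

/-- The application `k n`, phrased so that reduction evaluates `n` first. -/
def applyValue (n : ℕ) (k : ℕ → Bool) : Bool :=
  match n with
  | 0 => k 0
  | m + 1 => k m.succ

theorem applyValue_eq (n : ℕ) (k : ℕ → Bool) : applyValue n k = k n := by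
  cases n <;> rfl

/-- Given `P` with digits `overpartitionFn (n - 1), …, overpartitionFn 0`, compute the following
values of `overpartitionFn` and test the inequality for them. -/
def turanCheck : ℕ → ℕ → ℕ → Bool
  | 0, _, _ => true
  | f + 1, n, P =>
    applyValue (2 * digitSum P 1 16 - 2 * digitSum P 2 16) fun v ↦
      Nat.blt v (2 ^ 136) &&
      (Nat.blt n 10 ||
        Nat.blt (digit P 2 * digit P 0 + digit P 1 * digit P 0 + digit P 1 * v)
          (digit P 1 * digit P 1 + digit P 0 * digit P 0 + digit P 2 * v)) &&
      applyValue (P * 2 ^ 136 + v) fun P' ↦ turanCheck f n.succ P'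

theorem turanCheck_eq_true : turanCheck 1002 1 1 = true := by decide +kernel

theorem sum_neg_one_pow_mul (D : ℕ → ℤ) (k : ℕ) :
    ∑ i ∈ Finset.range (2 * k), (-1) ^ i * D i =
      ∑ i ∈ Finset.range k, D (2 * i) - ∑ i ∈ Finset.range k, D (2 * i + 1) := by
  induction k with
  | zero => simp
  | succ k ih =>
    rw [Nat.mul_succ, Finset.sum_range_succ, Finset.sum_range_succ, ih, Finset.sum_range_succ,
      Finset.sum_range_succ, pow_succ, pow_mul]
    simp
    ring

theorem overpartitionFn_eq_digitSum {n P : ℕ} (hn : 1 ≤ n) (hn' : n < 1089)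
    (hP : ∀ j, digit P j = if j < n then overpartitionFn (n - 1 - j) else 0) :
    2 * digitSum P 1 16 - 2 * digitSum P 2 16 = overpartitionFn n := by
  have h := overpartitionFn_recurrence hn hn'
  have e : ∀ i : ℕ, (if (i + 1) ^ 2 ≤ n then (overpartitionFn (n - (i + 1) ^ 2) : ℤ) else 0) =
      (digit P ((i + 1) ^ 2 - 1) : ℤ) := fun i ↦ by
    have h1 : 0 < (i + 1) ^ 2 := by positivity
    rw [hP]
    by_cases h2 : (i + 1) ^ 2 ≤ n
    · rw [if_pos h2, if_pos (by omega)]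
      congr 2
      omega
    · rw [if_neg h2, if_neg (by omega)]
      rfl
  simp only [e] at h
  rw [sum_neg_one_pow_mul (fun i ↦ (digit P ((i + 1) ^ 2 - 1) : ℤ)) 16] at h
  have e1 := digitSum_eq P 1 16
  have e2 := digitSum_eq P 2 16
  zify at e1 e2
  simp only [add_assoc, one_add_one_eq_two] at h
  rw [← e1, ← e2] at h
  omega

theorem digit_mul_add_zero {P v : ℕ} (hv : v < 2 ^ 136) : digit (P * 2 ^ 136 + v) 0 = v := by
  rw [digit, pow_zero, Nat.div_one, Nat.mul_add_mod_self_right, Nat.mod_eq_of_lt hv]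

theorem digit_mul_add_succ {P v : ℕ} (hv : v < 2 ^ 136) (j : ℕ) :
    digit (P * 2 ^ 136 + v) (j + 1) = digit P j := by
  rw [digit, digit, pow_succ' _ j, ← Nat.div_div_eq_div_mul]
  congr 2
  omega

theorem turanCheck_sound (f : ℕ) : ∀ {n P : ℕ}, 1 ≤ n → n + f < 1089 →
    (∀ j, digit P j = if j < n then overpartitionFn (n - 1 - j) else 0) →
    turanCheck f n P = true → ∀ m, 10 ≤ m → n ≤ m → m < n + f →
    overpartitionFn (m - 3) * overpartitionFn (m - 1) +
        overpartitionFn (m - 2) * overpartitionFn (m - 1) +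
        overpartitionFn (m - 2) * overpartitionFn m <
      overpartitionFn (m - 2) * overpartitionFn (m - 2) +
        overpartitionFn (m - 1) * overpartitionFn (m - 1) +
        overpartitionFn (m - 3) * overpartitionFn m := by
  induction f with
  | zero => intro n P _ _ _ _ m _ _ _; omega
  | succ f ih =>
    intro n P hn hnf hP hc m hm hnm hmf
    rw [turanCheck, applyValue_eq, applyValue_eq, overpartitionFn_eq_digitSum hn (by omega) hP,
      Bool.and_eq_true, Bool.and_eq_true, Bool.or_eq_true, Nat.blt_eq, Nat.blt_eq,
      Nat.blt_eq] at hc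
    obtain ⟨⟨h1, h2⟩, h3⟩ := hc
    rcases hnm.eq_or_lt with rfl | hlt
    · have h4 := h2.resolve_left (by omega)
      rw [hP, hP, hP, if_pos (by omega), if_pos (by omega), if_pos (by omega)] at h4
      exact h4
    · refine ih (n := n + 1) (by omega) (by omega) (fun j ↦ ?_) h3 m hm hlt (by omega)
      rcases j with _ | j
      · rw [digit_mul_add_zero h1, if_pos (by omega)]
        rfl
      · rw [digit_mul_add_succ h1, hP]
        simp only [Nat.add_lt_add_iff_right]
        congr 2
        omega

theorem turan_of_small {m : ℕ} (hm : 10 ≤ m) (hm' : m < 1003) :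
    overpartitionFn (m - 3) * overpartitionFn (m - 1) +
        overpartitionFn (m - 2) * overpartitionFn (m - 1) +
        overpartitionFn (m - 2) * overpartitionFn m <
      overpartitionFn (m - 2) * overpartitionFn (m - 2) +
        overpartitionFn (m - 1) * overpartitionFn (m - 1) +
        overpartitionFn (m - 3) * overpartitionFn m := by
  have h0 : overpartitionFn 0 = 1 := by
    have := sum_antidiagonal_overpartitionFn_mul_thetaCoeff 0
    simpa [thetaCoeff] using this
  refine turanCheck_sound 1002 le_rfl (by omega) (fun j ↦ ?_) turanCheck_eq_true m hm (by omega)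
    (by omega)
  rcases j with _ | j
  · simp [h0, digit]
  · have h1 : 1 < (2 ^ 136) ^ (j + 1) := Nat.one_lt_pow (by omega) (by norm_num)
    rw [digit, Nat.div_eq_of_lt h1, if_neg (by omega)]
    rfl

end Overpartition

theorem turan_expanded_pbar (n : ℕ) (hn : 8 ≤ n) :
    ((overpartitionFn n : ℤ)) ^ 2 - overpartitionFn (n - 1) * overpartitionFn (n + 1)
      - overpartitionFn n * overpartitionFn (n + 1) + (overpartitionFn (n + 1) : ℤ) ^ 2
      + overpartitionFn (n - 1) * overpartitionFn (n + 2)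
      - overpartitionFn n * overpartitionFn (n + 2) > 0 := by
  have key : overpartitionFn (n - 1) * overpartitionFn (n + 1) +
      overpartitionFn n * overpartitionFn (n + 1) + overpartitionFn n * overpartitionFn (n + 2) <
      overpartitionFn n * overpartitionFn n + overpartitionFn (n + 1) * overpartitionFn (n + 1) +
        overpartitionFn (n - 1) * overpartitionFn (n + 2) := by
    obtain ⟨m, rfl⟩ : ∃ m, n = m + 1 := ⟨n - 1, by omega⟩
    rw [Nat.add_sub_cancel]
    rcases lt_or_ge m 1000 with h | h
    · exact Overpartition.turan_of_small (m := m + 3) (by omega) (by omega)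
    · have := Overpartition.mul_lt_sq_of_large h
      have : (overpartitionFn m * overpartitionFn (m + 2) +
          overpartitionFn (m + 1) * overpartitionFn (m + 2) +
          overpartitionFn (m + 1) * overpartitionFn (m + 3) : ℝ) <
          overpartitionFn (m + 1) * overpartitionFn (m + 1) +
          overpartitionFn (m + 2) * overpartitionFn (m + 2) +
          overpartitionFn m * overpartitionFn (m + 3) := by linarith
      exact_mod_cast this
  zify at key
  linarith
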